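/- arXiv:2107.03269 — 6 statements merged into one kernel-verified Lean document; each statement's English description precedes it below -/
import Mathlib

section
/- Let G be a finite simple group in which every proper subgroup is abelian. Then G is abelian (and hence cyclic of prime order). Equivalently, every finite simple group other than the cyclic groups of prime order possesses a nonabelian proper subgroup. -/
/-- A finite simple `p`-group is commutative. -/
theorem IsPGroup.mul_comm_of_isSimpleGroup {G : Type*} [Group G] [Finite G] [IsSimpleGroup G]
    {p : ℕ} [Fact p.Prime] (hG : IsPGroup p G) (a b : G) : a * b = b * a := by
  have := hG.center_nontrivial
  have hc : Subgroup.center G = ⊤ :=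
    (inferInstance : (Subgroup.center G).Normal).eq_bot_or_eq_top.resolve_left
      ((Subgroup.nontrivial_iff_ne_bot _).1 this)
  exact Subgroup.mem_center_iff.1 (hc ▸ Subgroup.mem_top b) a

/-- In a finite simple group, a nontrivial Sylow subgroup that is central in its normalizer is the
whole group. -/
theorem Sylow.eq_top_of_normalizer_le_centralizer {G : Type*} [Group G] [Finite G]
    [IsSimpleGroup G] {p : ℕ} [Fact p.Prime] (P : Sylow p G) (hP : (P : Subgroup G) ≠ ⊥)
    (hN : Subgroup.normalizer (P : Set G) ≤ Subgroup.centralizer (P : Set G)) :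
    (P : Subgroup G) = ⊤ := by
  have hc := MonoidHom.ker_transferSylow_isComplement' P hN
  rcases (MonoidHom.normal_ker (MonoidHom.transferSylow P hN)).eq_bot_or_eq_top with hk | hk
  · rwa [hk, Subgroup.isComplement'_bot_left] at hc
  · rw [hk, Subgroup.isComplement'_top_left] at hc
    exact absurd hc hP

/-- A finite simple group in which every proper subgroup is abelian is itself abelian,
and hence cyclic of prime order. -/
theorem finite_simple_group_all_proper_subgroups_abelian
    (G : Type*) [Group G] [Finite G] [IsSimpleGroup G]
    (h : ∀ H : Subgroup G, H ≠ ⊤ → ∀ a b : H, a * b = b * a) :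
    (∀ a b : G, a * b = b * a) ∧ IsCyclic G ∧ (Nat.card G).Prime := by
  have hcomm : ∀ a b : G, a * b = b * a := by
    obtain ⟨p, hp, hpG⟩ := Nat.exists_prime_and_dvd (Finite.one_lt_card (α := G)).ne'
    have : Fact p.Prime := ⟨hp⟩
    obtain ⟨P⟩ := Sylow.nonempty (p := p) (G := G)
    have hbot := P.ne_bot_of_dvd_card hpG
    have htop : (P : Subgroup G) = ⊤ := by
      by_cases hN : Subgroup.normalizer (P : Set G) = ⊤
      · exact (Subgroup.normalizer_eq_top_iff.1 hN).eq_bot_or_eq_top.resolve_left hbot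
      · refine P.eq_top_of_normalizer_le_centralizer hbot fun x hx y hy => ?_
        exact congrArg Subtype.val (h _ hN ⟨y, Subgroup.le_normalizer hy⟩ ⟨x, hx⟩)
    have hG : IsPGroup p G := by
      have hP := P.isPGroup'
      rw [htop] at hP
      exact hP.of_equiv Subgroup.topEquiv
    exact hG.mul_comm_of_isSimpleGroup
  let : CommGroup G := { (inferInstance : Group G) with mul_comm := hcomm }
  exact ⟨hcomm, IsSimpleGroup.isCyclic, IsSimpleGroup.prime_card⟩
end

section
/- Let G be a finite group all of whose irreducible finite-dimensional complex representations have degree at most 2. Then G has an abelian normal subgroup N such that the quotient G/N is abelian. -/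
open CategoryTheory

/-- In characteristic zero, two `2 × 2` matrices commuting with a nonzero traceless matrix commute. -/
theorem Matrix.commute_of_commute_traceless {k : Type*} [Field k] [CharZero k]
    {A B C : Matrix (Fin 2) (Fin 2) k} (hA : A ≠ 0) (htr : A.trace = 0)
    (hB : Commute A B) (hC : Commute A C) : Commute B C := by
  have key : ∀ X : Matrix (Fin 2) (Fin 2) k, Commute A X →
      A 0 1 * X 1 0 = X 0 1 * A 1 0 ∧ 2 * A 0 0 * X 0 1 = A 0 1 * (X 0 0 - X 1 1) ∧
      2 * A 0 0 * X 1 0 = A 1 0 * (X 0 0 - X 1 1) := by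
    intro X hX
    have h (i j : Fin 2) := congrFun (congrFun hX.eq i) j
    have h00 := h 0 0
    have h01 := h 0 1
    have h10 := h 1 0
    simp only [Matrix.mul_apply, Fin.sum_univ_two] at h00 h01 h10
    rw [Matrix.trace_fin_two] at htr
    refine ⟨by linear_combination h00, by linear_combination h01 + X 0 1 * htr, ?_⟩
    linear_combination -h10 + X 1 0 * htr
  obtain ⟨hB₁, hB₂, hB₃⟩ := key B hB
  obtain ⟨hC₁, hC₂, hC₃⟩ := key C hC
  rw [Matrix.trace_fin_two] at htr
  have hne : A 0 1 ≠ 0 ∨ A 1 0 ≠ 0 ∨ A 0 0 ≠ 0 := by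
    by_contra! h0
    apply hA
    ext i j
    fin_cases i <;> fin_cases j <;> grind [Matrix.zero_apply]
  have h₁ : B 0 1 * C 1 0 = C 0 1 * B 1 0 := by grind
  have h₂ : B 0 1 * (C 0 0 - C 1 1) = C 0 1 * (B 0 0 - B 1 1) := by grind
  have h₃ : B 1 0 * (C 0 0 - C 1 1) = C 1 0 * (B 0 0 - B 1 1) := by grind
  ext i j
  fin_cases i <;> fin_cases j <;> simp [Matrix.mul_apply, Fin.sum_univ_two] <;> grind

theorem LinearMap.commute_of_commute_traceless {k V : Type*} [Field k] [CharZero k]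
    [AddCommGroup V] [Module k V] (hV : Module.finrank k V = 2) {A B C : Module.End k V}
    (hA : A ≠ 0) (htr : LinearMap.trace k V A = 0) (hB : Commute A B) (hC : Commute A C) :
    Commute B C := by
  have : Module.Finite k V := Module.finite_of_finrank_pos (by omega)
  let b := Module.finBasisOfFinrankEq k V hV
  let e := LinearMap.toMatrixAlgEquiv b
  refine Commute.of_map (f := e) e.injective
    (Matrix.commute_of_commute_traceless (A := e A) ?_ ?_ (hB.map e) (hC.map e))
  · simpa using hA
  · rw [← htr, LinearMap.trace_eq_matrix_trace k b]
    rfl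

namespace Representation

variable {k G V : Type*} [Field k] [Group G] [AddCommGroup V] [Module k V]

theorem exists_subrepresentation_isCompl_of_not_isIrreducible [Finite G]
    [NeZero (Nat.card G : k)] [Nontrivial V]
    (ρ : Representation k G V) (hρ : ¬ ρ.IsIrreducible) :
    ∃ S T : Subrepresentation ρ, IsCompl S.toSubmodule T.toSubmodule ∧
      S.toSubmodule ≠ ⊥ ∧ T.toSubmodule ≠ ⊥ := by
  have hnt : Nontrivial (Subrepresentation ρ) :=
    ⟨⊥, ⊤, fun h ↦ bot_ne_top (congrArg Subrepresentation.toSubmodule h)⟩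
  obtain ⟨S, hS₀, hS₁⟩ : ∃ S : Subrepresentation ρ, S ≠ ⊥ ∧ S ≠ ⊤ := by
    by_contra! h
    exact hρ ⟨fun S ↦ or_iff_not_imp_left.mpr (h S)⟩
  obtain ⟨T, hT⟩ := exists_isCompl S
  have hST : IsCompl S.toSubmodule T.toSubmodule :=
    ⟨disjoint_iff.mpr (congrArg Subrepresentation.toSubmodule hT.inf_eq_bot),
      codisjoint_iff.mpr (congrArg Subrepresentation.toSubmodule hT.sup_eq_top)⟩
  refine ⟨S, T, hST, fun h ↦ hS₀ (Subrepresentation.toSubmodule_injective h), fun h ↦ ?_⟩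
  rw [h] at hST
  exact hS₁ (Subrepresentation.toSubmodule_injective (eq_top_of_isCompl_bot hST))

/-- The conjugation representation on traceless endomorphisms. -/
noncomputable def tracelessSubrepresentation (ρ : Representation k G V) :
    Subrepresentation (linHom ρ ρ) where
  toSubmodule := LinearMap.ker (LinearMap.trace k V)
  apply_mem_toSubmodule g f hf := by
    rw [LinearMap.mem_ker] at hf ⊢
    rw [linHom_apply, ← Module.End.mul_eq_comp, ← Module.End.mul_eq_comp,
      LinearMap.trace_mul_comm, mul_assoc, ← map_mul, inv_mul_cancel, map_one, mul_one, hf]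

theorem finrank_tracelessSubrepresentation [CharZero k] (ρ : Representation k G V)
    (hV : Module.finrank k V = 2) :
    Module.finrank k ρ.tracelessSubrepresentation.toSubmodule = 3 := by
  have : Module.Finite k V := Module.finite_of_finrank_pos (by omega)
  have htr : LinearMap.trace k V ≠ 0 := fun h ↦ by
    simpa [hV] using congrArg (fun f ↦ f (1 : Module.End k V)) h
  have hsum := (LinearMap.trace k V).finrank_range_add_finrank_ker
  rw [LinearMap.range_eq_top.mpr (LinearMap.surjective_of_ne_zero htr), finrank_top,
    Module.finrank_self, Module.finrank_linearMap, hV] at hsum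
  change Module.finrank k (LinearMap.ker (LinearMap.trace k V)) = 3
  omega

theorem commute_of_mem_commutator (ρ : Representation k G V) {A : Module.End k V}
    (hA : ∀ g, ∃ c : k, linHom ρ ρ g A = c • A) {g : G} (hg : g ∈ commutator G) :
    Commute A (ρ g) := by
  let σ := linHom ρ ρ
  let H : Subgroup G :=
    { carrier := {g | σ g A = A}
      one_mem' := by simp
      mul_mem' := fun {a b} ha hb ↦ by
        simp only [Set.mem_ofPred_eq] at ha hb ⊢
        rw [map_mul, Module.End.mul_apply, hb, ha]
      inv_mem' := fun {a} ha ↦ by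
        simp only [Set.mem_ofPred_eq] at ha ⊢
        conv_lhs => rw [← ha]
        exact σ.inv_self_apply a A }
  have hH : commutator G ≤ H := by
    rw [commutator_def, Subgroup.commutator_le]
    rintro a - b -
    obtain ⟨c, hc⟩ := hA a⁻¹
    obtain ⟨d, hd⟩ := hA b⁻¹
    have hab : σ (a⁻¹ * b⁻¹) A = σ (b⁻¹ * a⁻¹) A := by
      simp [σ, hc, hd, map_mul, smul_smul, mul_comm, -linHom_apply]
    change σ (a * b * a⁻¹ * b⁻¹) A = A
    rw [mul_assoc, map_mul, Module.End.mul_apply, hab, ← mul_inv_rev]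
    exact σ.self_inv_apply (a * b) A
  have h : ρ g * (A * ρ g⁻¹) = A := hH hg
  change A * ρ g = ρ g * A
  nth_rewrite 1 [← h]
  rw [mul_assoc, mul_assoc, ← map_mul, inv_mul_cancel, map_one, mul_one]

theorem exists_eigenvector_of_finrank_eq_three [Finite G] [NeZero (Nat.card G : k)]
    (ρ : Representation k G V) (hV : Module.finrank k V = 3) (hρ : ¬ ρ.IsIrreducible) :
    ∃ v : V, v ≠ 0 ∧ ∀ g, ∃ c : k, ρ g v = c • v := by
  have : Module.Finite k V := Module.finite_of_finrank_pos (by omega)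
  have : Nontrivial V := Module.nontrivial_of_finrank_pos (R := k) (by omega)
  obtain ⟨S, T, hST, hS, hT⟩ := ρ.exists_subrepresentation_isCompl_of_not_isIrreducible hρ
  have hsum := Submodule.finrank_add_eq_of_isCompl hST
  have hS' := Submodule.one_le_finrank_iff.mpr hS
  have hT' := Submodule.one_le_finrank_iff.mpr hT
  obtain ⟨U, hU⟩ : ∃ U : Subrepresentation ρ, Module.finrank k U.toSubmodule = 1 := by
    obtain h | h : Module.finrank k S.toSubmodule = 1 ∨ Module.finrank k T.toSubmodule = 1 := by
      omega
    exacts [⟨S, h⟩, ⟨T, h⟩]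
  obtain ⟨⟨v, hvU⟩, hv₀, hv⟩ := finrank_eq_one_iff'.mp hU
  refine ⟨v, fun h ↦ hv₀ (Subtype.ext h), fun g ↦ ?_⟩
  obtain ⟨c, hc⟩ := hv ⟨_, U.apply_mem_toSubmodule g hvU⟩
  exact ⟨c, congrArg Subtype.val hc.symm⟩

theorem exists_traceless_eigenvector [Finite G] [NeZero (Nat.card G : k)] [CharZero k]
    (ρ : Representation k G V) (hV : Module.finrank k V = 2)
    (hρ : ¬ ρ.tracelessSubrepresentation.toRepresentation.IsIrreducible) :
    ∃ A : Module.End k V, A ≠ 0 ∧ LinearMap.trace k V A = 0 ∧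
      ∀ g, ∃ c : k, linHom ρ ρ g A = c • A := by
  obtain ⟨A, hA₀, hA⟩ := exists_eigenvector_of_finrank_eq_three _
    (ρ.finrank_tracelessSubrepresentation hV) hρ
  refine ⟨A, fun h ↦ hA₀ (Subtype.ext h), A.2, fun g ↦ ?_⟩
  obtain ⟨c, hc⟩ := hA g
  exact ⟨c, congrArg Subtype.val hc⟩

universe u

theorem commute_of_mem_commutator_of_irreducible_finrank_le_two {k G : Type*} {V : Type u}
    [Field k] [CharZero k] [Group G] [Finite G]
    [AddCommGroup V] [Module k V] [Module.Finite k V]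
    (h : ∀ (W : Type u) [AddCommGroup W] [Module k W] [Module.Finite k W]
      (σ : Representation k G W), σ.IsIrreducible → Module.finrank k W ≤ 2)
    (ρ : Representation k G V) {a b : G} (ha : a ∈ commutator G) (hb : b ∈ commutator G) :
    Commute (ρ a) (ρ b) := by
  induction hn : Module.finrank k V using Nat.strong_induction_on generalizing V with
  | _ n ih =>
  subst hn
  by_cases hρ : ρ.IsIrreducible
  · have hle := h V ρ hρ
    obtain h2 | h1 := hle.eq_or_lt
    · obtain ⟨A, hA₀, htr, hA⟩ := ρ.exists_traceless_eigenvector h2 fun hirr ↦ by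
        have := h _ _ hirr
        rw [ρ.finrank_tracelessSubrepresentation h2] at this
        omega
      exact LinearMap.commute_of_commute_traceless h2 hA₀ htr
        (ρ.commute_of_mem_commutator hA ha) (ρ.commute_of_mem_commutator hA hb)
    · have h1 : Module.finrank k V ≤ 1 := by omega
      obtain ⟨v, hv⟩ := finrank_le_one_iff.mp h1
      obtain ⟨c, hc⟩ := hv (ρ a v)
      obtain ⟨d, hd⟩ := hv (ρ b v)
      ext w
      obtain ⟨t, rfl⟩ := hv w
      simp [← hc, ← hd, smul_smul, mul_comm]
  · obtain hV | hV := subsingleton_or_nontrivial V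
    · exact Subsingleton.elim _ _
    obtain ⟨S, T, hST, hS, hT⟩ := ρ.exists_subrepresentation_isCompl_of_not_isIrreducible hρ
    have hsum := Submodule.finrank_add_eq_of_isCompl hST
    have hS' := Submodule.one_le_finrank_iff.mpr hS
    have hT' := Submodule.one_le_finrank_iff.mpr hT
    have hcomm (U : Subrepresentation ρ)
        (hU : Module.finrank k U.toSubmodule < Module.finrank k V) (u : V)
        (hu : u ∈ U.toSubmodule) : ρ a (ρ b u) = ρ b (ρ a u) :=
      congrArg Subtype.val (LinearMap.congr_fun (ih _ hU U.toRepresentation rfl).eq ⟨u, hu⟩)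
    ext v
    obtain ⟨s, hs, t, ht, rfl⟩ :=
      Submodule.mem_sup.mp (hST.sup_eq_top ▸ Submodule.mem_top : v ∈ _ ⊔ _)
    simp [hcomm S (by omega) s hs, hcomm T (by omega) t ht]

theorem IsIrreducible.simple_of {k G V : Type u} [Field k] [IsAlgClosed k] [Group G] [Finite G]
    [NeZero (Nat.card G : k)] [AddCommGroup V] [Module k V] [Module.Finite k V]
    {ρ : Representation k G V} (hρ : ρ.IsIrreducible) : Simple (FDRep.of ρ) := by
  rw [FDRep.simple_iff_end_is_rank_one]
  have : Nontrivial V := by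
    by_contra hV
    rw [not_nontrivial_iff_subsingleton] at hV
    exact bot_ne_top (α := Subrepresentation ρ)
      (Subrepresentation.toSubmodule_injective (Subsingleton.elim _ _))
  rw [finrank_eq_one_iff']
  refine ⟨𝟙 _, fun h ↦ ?_, fun f ↦ ?_⟩
  · obtain ⟨v, hv⟩ := exists_ne (0 : V)
    exact hv (congrArg (fun f : FDRep.of ρ ⟶ FDRep.of ρ ↦ f.hom.hom.hom v) h)
  · let φ : IntertwiningMap ρ ρ := f.hom.hom.hom.intertwiningMap_of_isIntertwiningMap ρ ρ
      fun g v ↦ congrArg (fun x ↦ x.hom.hom v) (f.comm g)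
    obtain ⟨c, hc⟩ := (IsIrreducible.algebraMap_intertwiningMap_bijective_of_isAlgClosed (ρ := ρ)).2 φ
    refine ⟨c, ?_⟩
    ext v
    exact congrArg (fun x : IntertwiningMap ρ ρ ↦ x v) hc

end Representation

theorem Representation.leftRegular_injective {k G : Type*} [Field k] [Group G] :
    Function.Injective (Representation.leftRegular k G) := by
  intro a b hab
  have := LinearMap.congr_fun hab (MonoidAlgebra.single 1 1)
  exact MonoidAlgebra.of_injective (R := k) (by simpa using this)

/-- A finite group all of whose irreducible finite-dimensional complex representations
have degree at most `2` has an abelian normal subgroup with abelian quotient.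
(The quotient `G/N` being abelian is expressed by all commutators lying in `N`.) -/
theorem abelian_normal_subgroup_of_irreps_degree_le_two
    (G : Type) [Group G] [Finite G]
    (h : ∀ V : FDRep ℂ G, Simple V → Module.finrank ℂ V ≤ 2) :
    ∃ N : Subgroup G, N.Normal ∧ (∀ a b : N, a * b = b * a) ∧
      (∀ a b : G, a * b * a⁻¹ * b⁻¹ ∈ N) := by
  refine ⟨commutator G, inferInstance, fun a b ↦ Subtype.ext ?_, fun a b ↦
    Subgroup.commutator_mem_commutator (Subgroup.mem_top a) (Subgroup.mem_top b)⟩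
  apply Representation.leftRegular_injective (k := ℂ)
  have := Representation.commute_of_mem_commutator_of_irreducible_finrank_le_two
    (fun W _ _ _ σ hσ ↦ h (FDRep.of σ) hσ.simple_of) (Representation.leftRegular ℂ G) a.2 b.2
  simpa using this.eq
end

section
/- (Huppert) Let G be a finite group and let N be a proper normal subgroup of G such that N is solvable, all Sylow subgroups of N are abelian, and the quotient G/N is supersolvable. Then G is monomial. -/
open Classical

open CategoryTheory

/-- The function on `G` induced from a function `f` on a subgroup `H`, given by the usual
induced-character formula `Ind_H^G f (g) = |H|⁻¹ * ∑_{x ∈ G, x g x⁻¹ ∈ H} f (x g x⁻¹)`. -/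
noncomputable def inducedCharFun {G : Type*} [Group G] [Fintype G]
    (H : Subgroup G) (f : H → ℂ) : G → ℂ := fun g =>
  (Nat.card H : ℂ)⁻¹ * ∑ x : G, if h : x * g * x⁻¹ ∈ H then f ⟨x * g * x⁻¹, h⟩ else 0

/-- A finite group is monomial if each of its irreducible finite-dimensional complex
representations is isomorphic to a representation induced from a one-dimensional
representation of some subgroup; since complex representations of finite groups are
determined up to isomorphism by their characters, this is expressed by saying that the
character of each irreducible representation is the character induced from a
one-dimensional character `ψ : H →* ℂˣ` of some subgroup `H`. -/
def IsMonomial (G : Type) [Group G] [Fintype G] : Prop :=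
  ∀ V : FDRep ℂ G, Simple V → ∃ (H : Subgroup G) (ψ : H →* ℂˣ),
    ∀ g : G, V.character g = inducedCharFun H (fun h => (ψ h : ℂ)) g

/-- A group is supersolvable if it has a finite chain of subgroups from `⊥` to `⊤`, each
normal in the whole group, with all successive quotients cyclic (the quotient
`s i.succ / s i.castSucc` being cyclic is expressed by the existence of an element `g`
whose powers cover `s i.succ` modulo `s i.castSucc`). -/
def IsSupersolvable (G : Type*) [Group G] : Prop :=
  ∃ (n : ℕ) (s : Fin (n + 1) → Subgroup G),
    s 0 = ⊥ ∧ s (Fin.last n) = ⊤ ∧ (∀ i, (s i).Normal) ∧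
    (∀ i : Fin n, s i.castSucc ≤ s i.succ) ∧
    (∀ i : Fin n, ∃ g ∈ s i.succ, ∀ x ∈ s i.succ, ∃ k : ℤ, g ^ k * x ∈ s i.castSucc)

open scoped commutatorElement

/-- A finite nilpotent group with abelian Sylow subgroups is abelian. -/
theorem Group.mul_comm_of_isNilpotent_of_sylow {Q : Type*} [Group Q] [Finite Q]
    [Group.IsNilpotent Q]
    (h : ∀ (p : ℕ) [Fact p.Prime] (P : Sylow p Q), ∀ a b : P, a * b = b * a) (x y : Q) :
    x * y = y * x := by
  obtain ⟨e⟩ := ((Group.isNilpotent_of_finite_tfae (G := Q)).out 0 4 rfl rfl).mp ‹_›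
  obtain ⟨a, rfl⟩ := e.surjective x
  obtain ⟨b, rfl⟩ := e.surjective y
  rw [← map_mul, ← map_mul]
  congr 1
  funext p P
  have : Fact (p : ℕ).Prime := ⟨Nat.prime_of_mem_primeFactors p.2⟩
  exact h p P _ _

/-- If a group with abelian Sylow subgroups maps onto a group whose commutators are central,
then the target is abelian. -/
theorem MonoidHom.commute_of_sylow_of_commutator_central {M E : Type*} [Group M] [Finite M]
    [Monoid E] (f : M →* E)
    (hS : ∀ (p : ℕ) [Fact p.Prime] (P : Sylow p M), ∀ a b : P, a * b = b * a)
    (hc : ∀ x y z : M, Commute (f ⁅x, y⁆) (f z)) (x y : M) : Commute (f x) (f y) := by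
  have hf : Function.Surjective (QuotientGroup.mk' f.ker) := QuotientGroup.mk'_surjective _
  have key : ∀ a b : M, QuotientGroup.mk' f.ker a = QuotientGroup.mk' f.ker b ↔ f a = f b := by
    intro a b
    rw [QuotientGroup.mk'_apply, QuotientGroup.mk'_apply, QuotientGroup.eq, MonoidHom.mem_ker,
      map_mul]
    constructor
    · intro h
      have := congrArg (f a * ·) h
      simpa [← mul_assoc, ← map_mul] using this.symm
    · intro h
      rw [← h, ← map_mul]; simp
  have hcen : ∀ a b : M ⧸ f.ker, ⁅a, b⁆ ∈ Subgroup.center (M ⧸ f.ker) := by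
    intro a b
    obtain ⟨a, rfl⟩ := hf a
    obtain ⟨b, rfl⟩ := hf b
    rw [Subgroup.mem_center_iff]
    intro c
    obtain ⟨c, rfl⟩ := hf c
    rw [← map_commutatorElement, ← map_mul, ← map_mul, key, map_mul, map_mul]
    exact (hc a b c).symm
  have hnil : Group.IsNilpotent (M ⧸ f.ker) := by
    apply Group.of_quotient_center_nilpotent
    let : CommGroup ((M ⧸ f.ker) ⧸ Subgroup.center (M ⧸ f.ker)) :=
      { (inferInstance : Group ((M ⧸ f.ker) ⧸ Subgroup.center (M ⧸ f.ker))) with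
        mul_comm := by
          intro a b
          obtain ⟨a, rfl⟩ := QuotientGroup.mk'_surjective _ a
          obtain ⟨b, rfl⟩ := QuotientGroup.mk'_surjective _ b
          rw [← commutatorElement_eq_one_iff_mul_comm, ← map_commutatorElement]
          exact (QuotientGroup.eq_one_iff _).2 (hcen a b) }
    exact CommGroup.isNilpotent
  have := Group.mul_comm_of_isNilpotent_of_sylow (Q := M ⧸ f.ker) (by
    intro p _ P a b
    obtain ⟨P, rfl⟩ := Sylow.mapSurjective_surjective hf p P
    obtain ⟨_, a, ha, rfl⟩ := a
    obtain ⟨_, b, hb, rfl⟩ := b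
    have := congrArg Subtype.val (hS p P ⟨a, ha⟩ ⟨b, hb⟩)
    apply Subtype.ext
    simpa using congrArg (QuotientGroup.mk' f.ker) this)
    (QuotientGroup.mk' f.ker x) (QuotientGroup.mk' f.ker y)
  rw [← map_mul, ← map_mul, key, map_mul, map_mul] at this
  exact this

/-- Two elements that are powers of a common element modulo a normal subgroup are already powers
modulo that subgroup of an element of the subgroup they generate. -/
theorem Subgroup.exists_zpow_mul_mem_of_zpow_mul_mem {Q : Type*} [Group Q] (A : Subgroup Q)
    [A.Normal] {g x y : Q} (hx : ∃ k : ℤ, g ^ k * x ∈ A) (hy : ∃ k : ℤ, g ^ k * y ∈ A) :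
    ∃ a b k l : ℤ, (x ^ a * y ^ b) ^ k * x ∈ A ∧ (x ^ a * y ^ b) ^ l * y ∈ A := by
  obtain ⟨m, hm⟩ := hx
  obtain ⟨n, hn⟩ := hy
  rw [← QuotientGroup.eq_one_iff] at hm hn
  rw [QuotientGroup.mk_mul, QuotientGroup.mk_zpow] at hm hn
  rw [mul_eq_one_iff_inv_eq, ← zpow_neg] at hm hn
  obtain ⟨u, hu⟩ := Int.gcd_dvd_left (a := -m) (b := -n)
  obtain ⟨v, hv⟩ := Int.gcd_dvd_right (a := -m) (b := -n)
  have hb := Int.gcd_eq_gcd_ab (-m) (-n)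
  refine ⟨Int.gcdA (-m) (-n), Int.gcdB (-m) (-n), -u, -v, ?_, ?_⟩ <;>
  · rw [← QuotientGroup.eq_one_iff]
    simp only [QuotientGroup.mk_mul, QuotientGroup.mk_zpow]
    rw [← hm, ← hn, ← zpow_mul, ← zpow_mul, ← zpow_add, ← hb, ← zpow_mul, ← zpow_add]
    convert zpow_zero _ using 2
    linarith

/-- Simultaneous eigenspaces of `f` inside `W` for distinct weights are independent. -/
theorem Module.End.iSupIndep_weightSpaces {k V ι : Type*} [Field k] [AddCommGroup V] [Module k V]
    (f : ι → Module.End k V) :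
    iSupIndep fun χ : ι → k => ⨅ i, (f i).eigenspace (χ i) := by
  rw [iSupIndep_iff_finsetSum_eq_zero_imp_eq_zero]
  intro s
  induction s using Finset.induction_on with
  | empty => simp
  | insert χ₀ s hχ₀ ih =>
    intro w hw hsum
    rw [Finset.sum_insert hχ₀] at hsum
    have hw' : ∀ χ ∈ insert χ₀ s, ∀ i, f i (w χ) = χ i • w χ := by
      intro χ hχ i
      have := hw χ hχ
      rw [Submodule.mem_iInf] at this
      exact Module.End.mem_eigenspace_iff.1 (this i)
    have hs : ∀ χ ∈ s, w χ = 0 := by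
      intro χ hχ
      obtain ⟨i, hi⟩ := Function.ne_iff.1 (fun h : χ = χ₀ => hχ₀ (h ▸ hχ))
      have := ih (fun χ => (χ i - χ₀ i) • w χ)
        (fun χ hχ => Submodule.smul_mem _ _ (hw χ (Finset.mem_insert_of_mem hχ))) (by
          have h := congrArg (f i) hsum
          rw [map_add, map_sum, map_zero, hw' _ (Finset.mem_insert_self _ _),
            Finset.sum_congr rfl (fun χ hχ => hw' χ (Finset.mem_insert_of_mem hχ) i)] at h
          have h2 := congrArg (χ₀ i • ·) hsum
          simp only [smul_add, smul_zero, Finset.smul_sum] at h2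
          simp only [sub_smul, Finset.sum_sub_distrib]
          rw [← sub_zero (0 : V)]
          nth_rw 2 [← h2]
          rw [← h]
          abel) χ hχ
      exact (smul_eq_zero.1 this).resolve_left (sub_ne_zero.2 hi)
    intro χ hχ
    rcases Finset.mem_insert.1 hχ with rfl | hχ
    · rwa [Finset.sum_eq_zero hs, add_zero] at hsum
    · exact hs χ hχ

/-- The dimensions of independent subspaces of `W` add up to at most the dimension of `W`. -/
theorem iSupIndep.sum_finrank_le {k V ι : Type*} [Field k] [AddCommGroup V] [Module k V]
    [FiniteDimensional k V] [Fintype ι] {p : ι → Submodule k V} (hp : iSupIndep p)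
    {W : Submodule k V} (hW : ∀ i, p i ≤ W) :
    ∑ i, Module.finrank k (p i) ≤ Module.finrank k W := by
  rw [← Module.finrank_directSum]
  refine LinearMap.finrank_le_finrank_of_injective
    (f := (DirectSum.coeLinearMap p).codRestrict W ?_) ?_
  · intro x
    induction x using DirectSum.induction_on with
    | zero => simp
    | of i x => simpa using hW i x.2
    | add x y hx hy => rw [map_add]; exact W.add_mem hx hy
  · exact fun a b h => hp.dfinsupp_lsum_injective (congrArg Subtype.val h)

/-- Operators preserving `W` and pairwise commuting on `W ≠ ⊥` have a common eigenvector in `W`. -/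
theorem Module.End.exists_common_eigenvector {k V ι : Type*} [Field k] [IsAlgClosed k]
    [AddCommGroup V] [Module k V] [FiniteDimensional k V] (f : ι → Module.End k V)
    (W : Submodule k V) (hW : W ≠ ⊥) (hf : ∀ i, ∀ w ∈ W, f i w ∈ W)
    (hc : ∀ i j, ∀ w ∈ W, f i (f j w) = f j (f i w)) :
    ∃ w ∈ W, w ≠ 0 ∧ ∃ χ : ι → k, ∀ i, f i w = χ i • w := by
  induction hn : Module.finrank k W using Nat.strong_induction_on generalizing W with
  | _ n ih =>
    by_cases hs : ∀ i, ∃ c : k, ∀ w ∈ W, f i w = c • w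
    · choose χ hχ using hs
      obtain ⟨w, hw, hw0⟩ := W.exists_mem_ne_zero_of_ne_bot hW
      exact ⟨w, hw, hw0, χ, fun i => hχ i w hw⟩
    push Not at hs
    obtain ⟨i, hi⟩ := hs
    have : Nontrivial W := Submodule.nontrivial_iff_ne_bot.2 hW
    obtain ⟨c, hcv⟩ := Module.End.exists_eigenvalue ((f i).restrict (hf i))
    obtain ⟨v, hv⟩ := hcv.exists_hasEigenvector
    have hle : W ⊓ (f i).eigenspace c ≤ W := inf_le_left
    have hlt : W ⊓ (f i).eigenspace c < W := by
      refine lt_of_le_of_ne hle fun h => ?_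
      obtain ⟨w, hw, hne⟩ := hi c
      rw [← h] at hw
      exact hne (Module.End.mem_eigenspace_iff.1 hw.2)
    obtain ⟨w, hw, h⟩ := ih _ (hn ▸ Submodule.finrank_lt_finrank_of_lt hlt)
      (W ⊓ (f i).eigenspace c)
      (by
        rw [Submodule.ne_bot_iff]
        exact ⟨v, ⟨v.2, Module.End.mem_eigenspace_iff.2 (congrArg Subtype.val hv.apply_eq_smul)⟩,
          fun h => hv.2 (Subtype.ext h)⟩)
      (fun j w hw => ⟨hf j w hw.1, Module.End.mem_eigenspace_iff.2 <| by
        rw [hc i j w hw.1, Module.End.mem_eigenspace_iff.1 hw.2,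
          map_smul]⟩)
      (fun a b w hw => hc a b w hw.1) rfl
    exact ⟨w, hw.1, h⟩

/-- The action of `G` on the subspaces of a representation. -/
@[reducible] def Representation.submoduleMulAction {k G V : Type*} [Field k] [Group G]
    [AddCommGroup V] [Module k V] (ρ : Representation k G V) : MulAction G (Submodule k V) where
  smul g U := U.map (ρ g)
  one_smul U := by
    change U.map (ρ 1) = U
    rw [map_one]; exact Submodule.map_id U
  mul_smul g h U := by
    change U.map (ρ (g * h)) = (U.map (ρ h)).map (ρ g)
    rw [map_mul, ← Submodule.map_comp]; rfl

theorem Representation.finrank_map_eq {k G V : Type*} [Field k] [Group G] [AddCommGroup V]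
    [Module k V] (ρ : Representation k G V) (g : G) (U : Submodule k V) :
    Module.finrank k (U.map (ρ g)) = Module.finrank k U :=
  (Submodule.equivMapOfInjective (ρ g) (ρ.apply_bijective g).injective U).finrank_eq.symm

/-- If a normal subgroup `M` of `G` acts on an invariant subspace `W` by commuting operators that
are not all scalar, then a weight space of `M` in `W` is a proper subspace whose `G`-translates
are independent. -/
theorem Representation.exists_lt_of_commute {k G V : Type*} [Field k] [IsAlgClosed k] [Group G]
    [Finite G] [AddCommGroup V] [Module k V] [FiniteDimensional k V] (ρ : Representation k G V)
    (M : Subgroup G) [M.Normal] (W : Submodule k V) (hW : W ≠ ⊥) (hst : ∀ g, ∀ w ∈ W, ρ g w ∈ W)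
    (hc : ∀ m ∈ M, ∀ n ∈ M, ∀ w ∈ W, ρ m (ρ n w) = ρ n (ρ m w))
    (hns : ∃ m ∈ M, ∀ c : k, ∃ w ∈ W, ρ m w ≠ c • w) :
    ∃ (T : Subgroup G) (U : Submodule k V), U < W ∧ U ≠ ⊥ ∧ (∀ t ∈ T, ∀ u ∈ U, ρ t u ∈ U) ∧
      Nat.card G * Module.finrank k U ≤ Nat.card T * Module.finrank k W := by
  let wt : (M → k) → Submodule k V := fun χ => W ⊓ ⨅ m : M, Module.End.eigenspace (ρ m) (χ m)
  have mem_wt : ∀ χ w, w ∈ wt χ ↔ w ∈ W ∧ ∀ m : M, ρ m w = χ m • w := by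
    intro χ w
    simp only [wt, Submodule.mem_inf, Submodule.mem_iInf, Module.End.mem_eigenspace_iff]
  obtain ⟨w₀, hw₀, hne, χ, hχ⟩ := Module.End.exists_common_eigenvector
    (fun m : M => (ρ m : Module.End k V)) W hW (fun m => hst m)
    (fun m n w hw => hc m m.2 n n.2 w hw)
  let act := ρ.submoduleMulAction
  have map_wt : ∀ (g : G) χ, ∃ χ', g • wt χ = wt χ' := by
    intro g χ
    refine ⟨fun m => χ ⟨g⁻¹ * m * g, by simpa using ‹M.Normal›.conj_mem m m.2 g⁻¹⟩, ?_⟩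
    change (wt χ).map (ρ g) = _
    ext w
    rw [Submodule.mem_map, mem_wt]
    constructor
    · rintro ⟨u, hu, rfl⟩
      rw [mem_wt] at hu
      refine ⟨hst g u hu.1, fun m => ?_⟩
      have := hu.2 ⟨g⁻¹ * m * g, by simpa using ‹M.Normal›.conj_mem m m.2 g⁻¹⟩
      rw [← map_smul, ← this, ← Module.End.mul_apply, ← Module.End.mul_apply, ← map_mul, ← map_mul]
      congr 2
      group
    · rintro ⟨hw, h⟩
      refine ⟨ρ g⁻¹ w, (mem_wt _ _).2 ⟨hst _ _ hw, fun m => ?_⟩, by simp⟩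
      have := h ⟨g * m * g⁻¹, ‹M.Normal›.conj_mem m m.2 g⟩
      have h2 : (⟨g⁻¹ * (g * m * g⁻¹) * g, by simp [mul_assoc]⟩ : M) = m := by
        ext; simp [mul_assoc]
      simp only [h2] at this
      rw [← map_smul, ← this, ← Module.End.mul_apply, ← Module.End.mul_apply, ← map_mul, ← map_mul]
      congr 2
      group
  have horb : ∀ X : MulAction.orbit G (wt χ), ∃ χ', X.1 = wt χ' := by
    rintro ⟨_, g, rfl⟩
    exact map_wt g χ
  choose ψ hψ using horb
  have hψinj : Function.Injective ψ := fun X Y h => Subtype.ext (by rw [hψ, hψ, h])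
  have hind : iSupIndep fun X : MulAction.orbit G (wt χ) => X.1 :=
    ((Module.End.iSupIndep_weightSpaces fun m : M => (ρ m : Module.End k V)).comp hψinj).mono
      fun X => (hψ X).le.trans inf_le_right
  have : Finite (MulAction.orbit G (wt χ)) := (Set.finite_range fun g : G => g • wt χ).to_subtype
  have : Fintype (MulAction.orbit G (wt χ)) := Fintype.ofFinite _
  have hdim := hind.sum_finrank_le (W := W) fun X => (hψ X).le.trans inf_le_left
  have hfr : ∀ X : MulAction.orbit G (wt χ), Module.finrank k X.1 = Module.finrank k (wt χ) := by
    rintro ⟨_, g, rfl⟩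
    exact ρ.finrank_map_eq g _
  simp only [hfr, Finset.sum_const, Finset.card_univ, smul_eq_mul] at hdim
  rw [← Nat.card_eq_fintype_card] at hdim
  refine ⟨MulAction.stabilizer G (wt χ), wt χ, lt_of_le_of_ne inf_le_left fun h => ?_, ?_, ?_, ?_⟩
  · obtain ⟨m, hm, hns⟩ := hns
    obtain ⟨w, hw, hne⟩ := hns (χ ⟨m, hm⟩)
    rw [← h] at hw
    exact hne (((mem_wt _ _).1 hw).2 ⟨m, hm⟩)
  · rw [Submodule.ne_bot_iff]
    exact ⟨w₀, (mem_wt _ _).2 ⟨hw₀, hχ⟩, hne⟩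
  · intro t ht u hu
    rw [← MulAction.mem_stabilizer_iff.1 ht]
    exact Submodule.mem_map_of_mem hu
  · rw [← (MulAction.stabilizer G (wt χ)).card_mul_index, MulAction.index_stabilizer, mul_assoc]
    exact Nat.mul_le_mul_left _ hdim

/-- An `H`-invariant subspace `W` on which every normal subgroup of `H` acting by commuting
operators acts by scalars is acted on by scalars by the whole of `H`, if the ambient group has a
normal subgroup as in Huppert's theorem. -/
theorem Representation.forall_scalar_of_huppert {k G V : Type*} [Field k] [Group G]
    [Finite G] [AddCommGroup V] [Module k V] (ρ : Representation k G V)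
    (N : Subgroup G) [N.Normal] (hsolv : Group.IsSolvable N)
    (hsylow : ∀ (p : ℕ) [Fact p.Prime] (P : Sylow p N), ∀ a b : P, a * b = b * a)
    (hsuper : IsSupersolvable (G ⧸ N)) (H : Subgroup G) (W : Submodule k V)
    (hst : ∀ h ∈ H, ∀ w ∈ W, ρ h w ∈ W)
    (hP : ∀ M ≤ H, (∀ h ∈ H, ∀ m ∈ M, h * m * h⁻¹ ∈ M) →
      (∀ m ∈ M, ∀ n ∈ M, ∀ w ∈ W, ρ m (ρ n w) = ρ n (ρ m w)) →
      ∀ m ∈ M, ∃ c : k, ∀ w ∈ W, ρ m w = c • w) :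
    ∀ h ∈ H, ∃ c : k, ∀ w ∈ W, ρ h w = c • w := by
  have norm : ∀ D : Subgroup G, D.Normal → ∀ h ∈ H, ∀ m ∈ D ⊓ H, h * m * h⁻¹ ∈ D ⊓ H :=
    fun D hD h hh m hm => ⟨hD.conj_mem m hm.1 h, H.mul_mem (H.mul_mem hh hm.2) (H.inv_mem hh)⟩
  have hder : ∀ i, (∀ m ∈ (derivedSeries N i).map N.subtype ⊓ H, ∃ c : k, ∀ w ∈ W, ρ m w = c • w) →
      ∀ m ∈ N ⊓ H, ∃ c : k, ∀ w ∈ W, ρ m w = c • w := by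
    intro i
    induction i with
    | zero =>
      intro h m hm
      exact h m ⟨⟨⟨m, hm.1⟩, by simp, rfl⟩, hm.2⟩
    | succ i ih =>
      intro h
      apply ih
      set D := (derivedSeries N i).map N.subtype with hD
      have hDN : D ≤ N := Subgroup.map_subtype_le _
      refine hP _ inf_le_right (norm D inferInstance) ?_
      let f : ↥(D ⊓ H) →* Module.End k W :=
        { toFun := fun m => (ρ m).restrict (hst m m.2.2)
          map_one' := by ext; simp
          map_mul' := fun x y => by ext; simp }
      have hf := f.commute_of_sylow_of_commutator_central ?_ ?_
      · intro m hm n hn w hw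
        exact congrArg Subtype.val (LinearMap.congr_fun (hf ⟨m, hm⟩ ⟨n, hn⟩) ⟨w, hw⟩)
      · intro p _ P a b
        have hMN : D ⊓ H ≤ N := inf_le_left.trans hDN
        obtain ⟨Q, hQ⟩ := (P.2.map (Subgroup.inclusion hMN)).exists_le_sylow
        have := hsylow p Q ⟨_, hQ ⟨a, a.2, rfl⟩⟩ ⟨_, hQ ⟨b, b.2, rfl⟩⟩
        have := congrArg (fun x : Q => ((x : N) : G)) this
        exact Subtype.ext (Subtype.ext this)
      · rintro ⟨x, ⟨x, hx, rfl⟩, hxH⟩ ⟨y, ⟨y, hy, rfl⟩, hyH⟩ z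
        obtain ⟨c, hc⟩ := h ⁅(x : G), (y : G)⁆ ⟨⟨⁅x, y⁆, by
          rw [derivedSeries_succ]; exact Subgroup.commutator_mem_commutator hx hy, rfl⟩,
          (⁅(⟨x, hxH⟩ : H), ⟨y, hyH⟩⁆ : H).2⟩
        ext w
        have h1 := hc w w.2
        have h2 := hc (ρ z w) (hst z z.2.2 w w.2)
        change ρ ⁅(x : G), (y : G)⁆ (ρ z w) = ρ z (ρ ⁅(x : G), (y : G)⁆ w)
        rw [h1, h2, map_smul]
  have hN : ∀ m ∈ N ⊓ H, ∃ c : k, ∀ w ∈ W, ρ m w = c • w := by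
    obtain ⟨n, hn⟩ := hsolv.solvable
    refine hder n ?_
    rintro m ⟨hm, -⟩
    have hm1 : m = 1 := by simpa [hn] using hm
    exact ⟨1, by simp [hm1]⟩
  obtain ⟨n, s, h0, hlast, hnormal, -, hcyc⟩ := hsuper
  have hchain : ∀ i, ∀ m ∈ (s i).comap (QuotientGroup.mk' N) ⊓ H,
      ∃ c : k, ∀ w ∈ W, ρ m w = c • w := by
    intro i
    induction i using Fin.induction with
    | zero =>
      rw [h0, MonoidHom.comap_bot, QuotientGroup.ker_mk']
      exact hN
    | succ i ih =>
      have := hnormal i.castSucc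
      refine hP _ inf_le_right (norm _ ((hnormal _).comap _)) ?_
      rintro x ⟨hx, hxH⟩ y ⟨hy, hyH⟩
      obtain ⟨g, -, hg⟩ := hcyc i
      obtain ⟨a, b, p, q, hp, hq⟩ :=
        Subgroup.exists_zpow_mul_mem_of_zpow_mul_mem _ (hg _ hx) (hg _ hy)
      rw [← map_zpow, ← map_zpow, ← map_mul, ← map_zpow, ← map_mul] at hp hq
      set z := x ^ a * y ^ b
      have hz : z ∈ H := H.mul_mem (H.zpow_mem hxH a) (H.zpow_mem hyH b)
      obtain ⟨c, hc⟩ := ih _ ⟨hp, H.mul_mem (H.zpow_mem hz p) hxH⟩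
      obtain ⟨d, hd⟩ := ih _ ⟨hq, H.mul_mem (H.zpow_mem hz q) hyH⟩
      have hx' : ∀ w ∈ W, ρ x w = c • ρ (z ^ (-p)) w := by
        intro w hw
        rw [← map_smul, ← hc w hw, ← Module.End.mul_apply, ← map_mul]
        simp
      have hy' : ∀ w ∈ W, ρ y w = d • ρ (z ^ (-q)) w := by
        intro w hw
        rw [← map_smul, ← hd w hw, ← Module.End.mul_apply, ← map_mul]
        simp
      intro w hw
      rw [hy' w hw, hx' w hw, map_smul, map_smul, hx' _ (hst _ (H.zpow_mem hz _) w hw),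
        hy' _ (hst _ (H.zpow_mem hz _) w hw), smul_comm, ← Module.End.mul_apply,
        ← Module.End.mul_apply, ← map_mul, ← map_mul, ← zpow_add, ← zpow_add, add_comm]
  intro h hh
  exact hchain (Fin.last n) h ⟨by rw [hlast]; trivial, hh⟩

/-- In a group as in Huppert's theorem, every `H`-invariant nonzero subspace `W` contains an
eigenvector of a subgroup of `H` of index at most the dimension of `W`. -/
theorem Representation.exists_eigenvector_of_huppert {k G V : Type*} [Field k] [IsAlgClosed k]
    [Group G] [Finite G] [AddCommGroup V] [Module k V] [FiniteDimensional k V]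
    (ρ : Representation k G V)
    (N : Subgroup G) [N.Normal] (hsolv : Group.IsSolvable N)
    (hsylow : ∀ (p : ℕ) [Fact p.Prime] (P : Sylow p N), ∀ a b : P, a * b = b * a)
    (hsuper : IsSupersolvable (G ⧸ N)) (H : Subgroup G) (W : Submodule k V) (hW : W ≠ ⊥)
    (hst : ∀ h ∈ H, ∀ w ∈ W, ρ h w ∈ W) :
    ∃ K : Subgroup G, ∃ v ∈ W, v ≠ 0 ∧ (∀ x ∈ K, ∃ c : k, ρ x v = c • v) ∧
      Nat.card H ≤ Module.finrank k W * Nat.card K := by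
  induction hn : Module.finrank k W using Nat.strong_induction_on generalizing H W with
  | _ n ih =>
    by_cases hM : ∀ M ≤ H, (∀ h ∈ H, ∀ m ∈ M, h * m * h⁻¹ ∈ M) →
      (∀ m ∈ M, ∀ n ∈ M, ∀ w ∈ W, ρ m (ρ n w) = ρ n (ρ m w)) →
      ∀ m ∈ M, ∃ c : k, ∀ w ∈ W, ρ m w = c • w
    · have := ρ.forall_scalar_of_huppert N hsolv hsylow hsuper H W hst hM
      obtain ⟨v, hv, hv0⟩ := W.exists_mem_ne_zero_of_ne_bot hW
      refine ⟨H, v, hv, hv0, fun x hx => (this x hx).imp fun c hc => hc v hv, ?_⟩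
      exact Nat.le_mul_of_pos_left _ (hn ▸ Submodule.one_le_finrank_iff.2 hW)
    push Not at hM
    obtain ⟨M, hMH, hMn, hMc, hMs⟩ := hM
    have : (M.subgroupOf H).Normal := ⟨fun m hm h => hMn h h.2 m hm⟩
    obtain ⟨T, U, hUW, hU, hTU, hcard⟩ := Representation.exists_lt_of_commute
      (ρ.comp H.subtype) (M.subgroupOf H) W hW (fun h => hst h h.2)
      (fun m hm n hn => hMc m hm n hn)
      (by obtain ⟨m, hm, h⟩ := hMs; exact ⟨⟨m, hMH hm⟩, hm, h⟩)
    obtain ⟨K, v, hv, hv0, hK, hTK⟩ := ih _ (hn ▸ Submodule.finrank_lt_finrank_of_lt hUW)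
      (T.map H.subtype) U hU (by rintro _ ⟨t, ht, rfl⟩; exact hTU t ht) rfl
    refine ⟨K, v, hUW.le hv, hv0, hK, ?_⟩
    rw [Subgroup.card_map_of_injective H.subtype_injective] at hTK
    have hpos : 0 < Module.finrank k U := Submodule.one_le_finrank_iff.2 hU
    refine Nat.le_of_mul_le_mul_right (hcard.trans ?_) hpos
    rw [hn]
    calc Nat.card T * n ≤ (Module.finrank k U * Nat.card K) * n := Nat.mul_le_mul_right _ hTK
      _ = _ := by ring

/-- If the translates of a `K`-eigenvector `v` of weight `ψ` span `V` and `[G : K] ≤ dim V`, then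
the character of `V` is induced from `ψ`. -/
theorem Representation.trace_eq_inducedCharFun {G V : Type*} [Group G] [Fintype G]
    [AddCommGroup V] [Module ℂ V] [FiniteDimensional ℂ V] (ρ : Representation ℂ G V)
    (K : Subgroup G) (ψ : K →* ℂˣ) (v : V) (hv : ∀ x : K, ρ x v = (ψ x : ℂ) • v)
    (hspan : ⊤ ≤ Submodule.span ℂ (Set.range fun g => ρ g v))
    (hcard : K.index ≤ Module.finrank ℂ V) (g : G) :
    LinearMap.trace ℂ V (ρ g) = inducedCharFun K (fun h => (ψ h : ℂ)) g := by
  let e : G ⧸ K → V := fun q => ρ q.out v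
  have he : ∀ x : G, ∃ h : (x : G ⧸ K).out⁻¹ * x ∈ K, ρ x v = (ψ ⟨_, h⟩ : ℂ) • e x := by
    intro x
    have h : (x : G ⧸ K).out⁻¹ * x ∈ K := QuotientGroup.eq.1 (QuotientGroup.out_eq' _)
    refine ⟨h, ?_⟩
    rw [← map_smul, ← hv, ← Module.End.mul_apply, ← map_mul]
    simp
  have hesp : ⊤ ≤ Submodule.span ℂ (Set.range e) := by
    refine hspan.trans (Submodule.span_le.2 ?_)
    rintro _ ⟨x, rfl⟩
    obtain ⟨h, hx⟩ := he x
    change ρ x v ∈ _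
    rw [hx]
    exact Submodule.smul_mem _ _ (Submodule.subset_span ⟨_, rfl⟩)
  have hc : Fintype.card (G ⧸ K) = Module.finrank ℂ V := by
    refine le_antisymm ?_ (finrank_le_of_span_eq_top (top_le_iff.1 hesp))
    rwa [← Nat.card_eq_fintype_card]
  let b := basisOfTopLeSpanOfCardEqFinrank e hesp hc
  have hb : ⇑b = e := coe_basisOfTopLeSpanOfCardEqFinrank e hesp hc
  let F : G → ℂ := fun x => if h : x * g * x⁻¹ ∈ K then (ψ ⟨x * g * x⁻¹, h⟩ : ℂ) else 0
  have hF : ∀ (y : K) (x : G), F (y * x) = F x := by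
    intro y x
    have hmem : y * x * g * (y * x : G)⁻¹ = y * (x * g * x⁻¹) * (y : G)⁻¹ := by group
    by_cases h : x * g * x⁻¹ ∈ K
    · have h' : y * x * g * (y * x : G)⁻¹ ∈ K := by
        rw [hmem]; exact K.mul_mem (K.mul_mem y.2 h) (K.inv_mem y.2)
      have hsub : (⟨_, h'⟩ : K) = y * ⟨_, h⟩ * y⁻¹ := Subtype.ext hmem
      simp only [F, dif_pos h, dif_pos h', hsub, map_mul, map_inv, mul_inv_cancel_comm]
    · have h' : y * x * g * (y * x : G)⁻¹ ∉ K := by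
        rw [hmem]
        intro h'
        exact h ((K.mul_mem_cancel_left y.2).1 ((K.mul_mem_cancel_right (K.inv_mem y.2)).1 h'))
      simp only [F, dif_neg h, dif_neg h']
  have htr : LinearMap.trace ℂ V (ρ g) = ∑ q : G ⧸ K, F q.out⁻¹ := by
    rw [LinearMap.trace_eq_matrix_trace ℂ b, Matrix.trace]
    refine Finset.sum_congr rfl fun q _ => ?_
    rw [Matrix.diag_apply, LinearMap.toMatrix_apply, hb]
    obtain ⟨h, hx⟩ := he (g * q.out)
    have hx' : ρ g (e q) = ρ (g * q.out) v := by rw [map_mul]; rfl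
    have hiff : ((g * q.out : G) : G ⧸ K) = q ↔ q.out⁻¹ * g * q.out⁻¹⁻¹ ∈ K := by
      rw [eq_comm]
      nth_rw 1 [← QuotientGroup.out_eq' q]
      rw [QuotientGroup.eq, inv_inv, mul_assoc]
    rw [hx', hx, ← hb, map_smul, Module.Basis.repr_self, Finsupp.smul_apply, smul_eq_mul]
    by_cases hq : ((g * q.out : G) : G ⧸ K) = q
    · have hmem := hiff.1 hq
      simp only [F, hq, Finsupp.single_eq_same, mul_one]
      rw [dif_pos hmem]
      simp only [inv_inv, mul_assoc]
    · simp only [F, dif_neg (mt hiff.2 hq), Finsupp.single_eq_of_ne (Ne.symm hq), mul_zero]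
  have hsum : ∑ x, F x = Nat.card K * ∑ q : G ⧸ K, F q.out⁻¹ := by
    have hfib : ∀ x : G, F x⁻¹ = F (x : G ⧸ K).out⁻¹ := by
      intro x
      have h : x⁻¹ * (x : G ⧸ K).out ∈ K := QuotientGroup.eq.1 (QuotientGroup.out_eq' _).symm
      rw [← hF ⟨_, h⟩ (x : G ⧸ K).out⁻¹]
      simp
    calc ∑ x, F x = ∑ x, F x⁻¹ := (Equiv.sum_comp (Equiv.inv G) F).symm
      _ = ∑ z : (G ⧸ K) × K, F z.1.out⁻¹ :=
        Fintype.sum_equiv Subgroup.groupEquivQuotientProdSubgroup _ _ hfib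
      _ = _ := by
        rw [Fintype.sum_prod_type]
        simp [Finset.mul_sum, Nat.card_eq_fintype_card]
  rw [htr, inducedCharFun, hsum, inv_mul_cancel_left₀ (by simp)]

/-- A nonzero invariant subspace of a simple object of `FDRep k G` is everything. -/
theorem FDRep.eq_top_of_simple {k : Type*} {G : Type*} [Field k] [Group G] (V : FDRep k G) [Simple V]
    (W : Submodule k V) (hW : W ≠ ⊥) (hst : ∀ g, ∀ w ∈ W, V.ρ g w ∈ W) : W = ⊤ := by
  let σ : Representation k G W := (Subrepresentation.mk (ρ := V.ρ) W hst).toRepresentation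
  let i : FDRep.of σ ⟶ V :=
    { hom := FGModuleCat.ofHom W.subtype
      comm := fun g => by
        ext w
        rfl }
  have : Mono i := by
    constructor
    intro Z a b h
    ext z
    exact congrArg (fun f : Z ⟶ V => f.hom.hom.hom z) h
  have hi : i ≠ 0 := by
    intro h
    obtain ⟨w, hw, hw0⟩ := W.exists_mem_ne_zero_of_ne_bot hW
    exact hw0 (congrArg (fun f : FDRep.of σ ⟶ V => f.hom.hom.hom ⟨w, hw⟩) h)
  have := isIso_of_mono_of_nonzero hi
  rw [eq_top_iff]
  intro v _
  have h := congrArg (fun f : V ⟶ V => f.hom.hom.hom v) (IsIso.inv_hom_id i)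
  have h2 : ((inv i).hom.hom.hom v).1 = v := h
  rw [← h2]
  exact Subtype.property _

/-- (Huppert) If a finite group `G` has a proper normal subgroup `N` such that `N` is
solvable with all Sylow subgroups abelian and `G/N` is supersolvable, then `G` is
monomial. -/
theorem isMonomial_of_huppert
    (G : Type) [Group G] [Fintype G] (N : Subgroup G) [N.Normal]
    (hproper : N ≠ ⊤) (hsolv : IsSolvable N)
    (hsylow : ∀ (p : ℕ) [Fact p.Prime] (P : Sylow p N), ∀ a b : P, a * b = b * a)
    (hsuper : IsSupersolvable (G ⧸ N)) :
    IsMonomial G := by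
  intro V hV
  have hV0 : (⊤ : Submodule ℂ V) ≠ ⊥ := by
    intro h
    refine id_nonzero V ?_
    ext v
    exact (Submodule.mem_bot ℂ).1 (h ▸ Submodule.mem_top : (v : V) ∈ (⊥ : Submodule ℂ V))
  obtain ⟨K, v, -, hv0, hK, hcard⟩ := Representation.exists_eigenvector_of_huppert V.ρ N hsolv
    hsylow hsuper ⊤ ⊤ hV0 (fun _ _ _ _ => Submodule.mem_top)
  rw [Subgroup.card_top, finrank_top, ← K.index_mul_card] at hcard
  choose c hc using fun x : K => hK x x.2
  have hcmul : ∀ x y, c (x * y) = c x * c y := by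
    intro x y
    refine smul_left_injective ℂ hv0 ?_
    change c (x * y) • v = (c x * c y) • v
    rw [← hc, mul_comm, mul_smul, ← hc, ← map_smul, ← hc, Subgroup.coe_mul, map_mul]
    rfl
  have hcone : c 1 = 1 := by
    refine smul_left_injective ℂ hv0 ?_
    change c 1 • v = (1 : ℂ) • v
    rw [← hc]
    simp
  let ψ : K →* ℂˣ := MonoidHom.toHomUnits ⟨⟨c, hcone⟩, hcmul⟩
  refine ⟨K, ψ, fun g => Representation.trace_eq_inducedCharFun V.ρ K ψ v hc ?_
    (Nat.le_of_mul_le_mul_right hcard Nat.card_pos) g⟩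
  refine (FDRep.eq_top_of_simple V _ ?_ ?_).ge
  · rw [Submodule.ne_bot_iff]
    exact ⟨v, Submodule.subset_span ⟨1, by simp⟩, hv0⟩
  · intro g w hw
    induction hw using Submodule.span_induction with
    | mem w hw =>
      obtain ⟨x, rfl⟩ := hw
      refine Submodule.subset_span ⟨g * x, ?_⟩
      simp
    | zero => simp
    | add a b _ _ ha hb => rw [map_add]; exact Submodule.add_mem _ ha hb
    | smul r a _ ha => rw [map_smul]; exact Submodule.smul_mem _ _ ha
end

section
/- Let G be a finite group possessing a normal subgroup N such that both N and the quotient G/N are abelian. Then G is monomial. -/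
open Classical

open CategoryTheory

open Module

namespace Representation

variable {k G V : Type*} [Field k] [Group G] [AddCommGroup V] [Module k V]
  (ρ : Representation k G V)

/-- The subgroup of elements acting on the vector `v` by a scalar. -/
def lineStabilizer (v : V) : Subgroup G where
  carrier := {g | ∃ c : k, ρ g v = c • v}
  one_mem' := ⟨1, by simp⟩
  mul_mem' := by
    rintro a b ⟨c, hc⟩ ⟨d, hd⟩
    exact ⟨d * c, by simp [hc, hd, smul_smul]⟩
  inv_mem' := by
    rintro a ⟨c, hc⟩
    have h : c • ρ a⁻¹ v = v := by rw [← map_smul, ← hc, inv_self_apply]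
    rcases eq_or_ne c 0 with rfl | h0
    · exact ⟨0, by rw [zero_smul] at h; simp [← h]⟩
    · exact ⟨c⁻¹, by rw [eq_inv_smul_iff₀ h0, h]⟩

/-- A vector spanning a line stable under `H` transforms under `H` by a character. -/
theorem exists_character_of_le_lineStabilizer {H : Subgroup G} {v : V} (hv : v ≠ 0)
    (hH : H ≤ ρ.lineStabilizer v) : ∃ ψ : H →* kˣ, ∀ h : H, ρ h v = (ψ h : k) • v := by
  choose c hc using fun h : H => hH h.2
  have hinj := smul_left_injective k hv
  let ψ : H →* k :=
    { toFun := c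
      map_one' := hinj <| by simp [← hc]
      map_mul' := fun a b => hinj <| by
        simp only [← hc]
        simp [hc, smul_smul, mul_comm] }
  exact ⟨ψ.toHomUnits, hc⟩

variable [IsAlgClosed k] [FiniteDimensional k V]

/-- If `t` normalizes `H` and fixes the character through which `H` acts on `v`, then `H` and `t`
have a common eigenvector. -/
theorem exists_le_lineStabilizer_of_conj {H : Subgroup G} {v : V} (hv : v ≠ 0) (ψ : H →* kˣ)
    (hψ : ∀ h : H, ρ h v = (ψ h : k) • v) {t : G}
    (ht : ∀ h : H, ∃ h' : H, t⁻¹ * h * t = h' ∧ ψ h' = ψ h) :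
    ∃ u : V, u ≠ 0 ∧ H ⊔ Subgroup.zpowers t ≤ ρ.lineStabilizer u := by
  let W : Submodule k V := ⨅ h : H, End.eigenspace (ρ h) (ψ h : k)
  have memW (u : V) : u ∈ W ↔ ∀ h : H, ρ h u = (ψ h : k) • u := by
    simp [W, Submodule.mem_iInf]
  have hW : ∀ u ∈ W, ρ t u ∈ W := by
    intro u hu
    rw [memW] at hu ⊢
    intro h
    obtain ⟨h', e, e'⟩ := ht h
    have : (h : G) * t = t * h' := by rw [← e]; group
    rw [← Module.End.mul_apply, ← map_mul, this, map_mul, Module.End.mul_apply, hu, map_smul, e']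
  have : Nontrivial W := ⟨⟨⟨v, (memW v).2 hψ⟩, 0, fun h => hv (congrArg Subtype.val h)⟩⟩
  obtain ⟨c, hc⟩ := End.exists_eigenvalue ((ρ t).restrict hW)
  obtain ⟨u, hu⟩ := hc.exists_hasEigenvector
  refine ⟨u, fun h => hu.2 (Subtype.ext h), sup_le (fun h hh => ⟨ψ ⟨h, hh⟩, ?_⟩) ?_⟩
  · exact (memW u).1 u.2 ⟨h, hh⟩
  · rw [Subgroup.zpowers_le]
    exact ⟨c, congrArg Subtype.val hu.apply_eq_smul⟩

/-- Elements of a finite commutative subgroup have a common eigenvector. -/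
theorem exists_le_lineStabilizer_of_comm [Finite G] [Nontrivial V] (N : Subgroup G)
    (hN : ∀ a b : N, a * b = b * a) : ∃ v : V, v ≠ 0 ∧ N ≤ ρ.lineStabilizer v := by
  obtain ⟨v₀, hv₀⟩ := exists_ne (0 : V)
  obtain ⟨H, hH⟩ := Set.Finite.exists_maximal
    (s := {H : Subgroup G | H ≤ N ∧ ∃ v : V, v ≠ 0 ∧ H ≤ ρ.lineStabilizer v}) (Set.toFinite _)
    ⟨⊥, bot_le, v₀, hv₀, bot_le⟩
  obtain ⟨hHN, v, hv, hHv⟩ := hH.prop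
  refine ⟨v, hv, le_trans (fun t ht => ?_) hHv⟩
  obtain ⟨ψ, hψ⟩ := ρ.exists_character_of_le_lineStabilizer hv hHv
  obtain ⟨u, hu, hle⟩ := ρ.exists_le_lineStabilizer_of_conj hv ψ hψ (t := t) fun h => by
    refine ⟨h, ?_, rfl⟩
    have := congrArg Subtype.val (hN ⟨h, hHN h.2⟩ ⟨t, ht⟩)
    simp only [Subgroup.coe_mul] at this
    rw [mul_assoc, this, inv_mul_cancel_left]
  exact hH.le_of_ge (y := H ⊔ Subgroup.zpowers t)
    ⟨sup_le hHN (by simpa using ht), u, hu, hle⟩ le_sup_left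
    (Subgroup.mem_sup_right (Subgroup.mem_zpowers t))

/-- If `G` has a commutative normal subgroup with commutative quotient, then some character of a
normal subgroup `H` of `G` occurs in `V` and is fixed under conjugation by elements of `H` only. -/
theorem exists_normal_character [Finite G] [Nontrivial V] (N : Subgroup G) [N.Normal]
    (hN : ∀ a b : N, a * b = b * a) (hQ : ∀ a b : G ⧸ N, a * b = b * a) :
    ∃ (H : Subgroup G) (_ : H.Normal) (ψ : H →* kˣ) (v : V), v ≠ 0 ∧
      (∀ h : H, ρ h v = (ψ h : k) • v) ∧
      ∀ t : G, (∀ h : H, ψ (MulAut.conjNormal t⁻¹ h) = ψ h) → t ∈ H := by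
  obtain ⟨H, hH⟩ := Set.Finite.exists_maximal
    (s := {H : Subgroup G | N ≤ H ∧ ∃ v : V, v ≠ 0 ∧ H ≤ ρ.lineStabilizer v}) (Set.toFinite _)
    ⟨N, le_rfl, ρ.exists_le_lineStabilizer_of_comm N hN⟩
  obtain ⟨hNH, v, hv, hHv⟩ := hH.prop
  have hnormal : H.Normal := ⟨fun h hh g => by
    have : (QuotientGroup.mk (g * h * g⁻¹) : G ⧸ N) = QuotientGroup.mk h := by
      rw [QuotientGroup.mk_mul, QuotientGroup.mk_mul, hQ (g : G ⧸ N), QuotientGroup.mk_inv,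
        mul_inv_cancel_right]
    have := H.mul_mem hh (H.inv_mem (hNH (QuotientGroup.eq.1 this)))
    simpa using this⟩
  obtain ⟨ψ, hψ⟩ := ρ.exists_character_of_le_lineStabilizer hv hHv
  refine ⟨H, hnormal, ψ, v, hv, hψ, fun t ht => ?_⟩
  obtain ⟨u, hu, hle⟩ := ρ.exists_le_lineStabilizer_of_conj hv ψ hψ (t := t) fun h =>
    ⟨MulAut.conjNormal t⁻¹ h, by simp, ht h⟩
  exact hH.le_of_ge (y := H ⊔ Subgroup.zpowers t)
    ⟨hNH.trans le_sup_left, u, hu, hle⟩ le_sup_left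
    (Subgroup.mem_sup_right (Subgroup.mem_zpowers t))

end Representation

/-- Simultaneous eigenvectors with pairwise distinct characters are linearly independent. -/
theorem linearIndependent_of_characters {ι k H V : Type*} [Field k] [Monoid H] [AddCommGroup V]
    [Module k V] (ρ : Representation k H V) (χ : ι → H →* k) (hχ : Function.Injective χ)
    (b : ι → V) (hb : ∀ i, b i ≠ 0) (hρ : ∀ i h, ρ h (b i) = χ i h • b i) :
    LinearIndependent k b := by
  rw [linearIndependent_iff']
  intro s c hc i hi
  have key : ∀ f : Dual k V, c i * f (b i) = 0 := fun f => by
    refine linearIndependent_iff'.1 ((linearIndependent_monoidHom H k).comp χ hχ) s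
      (fun j => c j * f (b j)) (funext fun h => ?_) i hi
    have := congrArg (fun v => f (ρ h v)) hc
    simpa [map_sum, hρ, mul_comm, mul_left_comm] using this
  have : c i • b i = 0 := (forall_dual_apply_eq_zero_iff k _).1 fun f => by simpa using key f
  exact (smul_eq_zero.1 this).resolve_right (hb i)

namespace Representation

variable {k G V : Type*} [Field k] [Group G] [AddCommGroup V] [Module k V]
  (ρ : Representation k G V)

/-- Up to a value of `ψ`, the action of `x` on an `H`-eigenvector is determined by `xH`. -/
theorem exists_apply_eq_smul_out {H : Subgroup G} {ψ : H →* kˣ} {v : V}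
    (hψ : ∀ h : H, ρ h v = (ψ h : k) • v) (x : G) :
    ∃ h : H, x = (x : G ⧸ H).out * h ∧ ρ x v = (ψ h : k) • ρ (x : G ⧸ H).out v := by
  obtain ⟨h, hh⟩ := QuotientGroup.mk_out_eq_mul H x
  have e : x = (x : G ⧸ H).out * (h⁻¹ : H) := eq_mul_inv_of_mul_eq hh.symm
  refine ⟨h⁻¹, e, ?_⟩
  conv_lhs => rw [e]
  rw [map_mul, Module.End.mul_apply, hψ, map_smul]

/-- If translates of an `H`-eigenvector by representatives of the cosets of `H` form a basis, the
character is given by the summation formula over cosets. -/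
theorem trace_eq_sum_quotient (H : Subgroup G) [Fintype (G ⧸ H)] (ψ : H →* kˣ) (v : V)
    (hψ : ∀ h : H, ρ h v = (ψ h : k) • v) (b : Basis (G ⧸ H) k V)
    (hb : ∀ q, b q = ρ q.out v) (g : G) :
    LinearMap.trace k V (ρ g) =
      ∑ q : G ⧸ H, if h : q.out⁻¹ * g * q.out ∈ H then (ψ ⟨_, h⟩ : k) else 0 := by
  rw [LinearMap.trace_eq_matrix_trace k b, Matrix.trace]
  refine Finset.sum_congr rfl fun q _ => ?_
  rw [Matrix.diag_apply, LinearMap.toMatrix_apply]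
  obtain ⟨h, hh, e⟩ := ρ.exists_apply_eq_smul_out hψ (g * q.out)
  rw [map_mul, Module.End.mul_apply, ← hb, ← hb] at e
  have hiff : q.out⁻¹ * g * q.out ∈ H ↔ ((g * q.out : G) : G ⧸ H) = q := by
    rw [mul_assoc, ← QuotientGroup.eq, QuotientGroup.out_eq', eq_comm]
  rw [e]
  split_ifs with hg
  · have hq := hiff.1 hg
    rw [hq] at hh ⊢
    have : h = ⟨_, hg⟩ := Subtype.ext <| by
      change (h : G) = q.out⁻¹ * g * q.out
      rw [mul_assoc, hh, inv_mul_cancel_left]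
    simp [this]
  · simp [mt hiff.2 hg]

/-- A nonzero `H`-eigenvector of an irreducible representation, with `H` normal, whose character
is fixed under conjugation by elements of `H` only, has translates forming a basis. -/
theorem exists_basis_of_normal_character (hρ : ∀ W : Submodule k V, W ≠ ⊥ →
      (∀ g, ∀ w ∈ W, ρ g w ∈ W) → W = ⊤)
    (H : Subgroup G) [H.Normal] (ψ : H →* kˣ) (v : V) (hv : v ≠ 0)
    (hψ : ∀ h : H, ρ h v = (ψ h : k) • v)
    (hH : ∀ t : G, (∀ h : H, ψ (MulAut.conjNormal t⁻¹ h) = ψ h) → t ∈ H) :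
    ∃ b : Basis (G ⧸ H) k V, ∀ q, b q = ρ q.out v := by
  let χ (q : G ⧸ H) : H →* k :=
    (Units.coeHom k).comp (ψ.comp (MulAut.conjNormal (q.out : G)⁻¹).toMonoidHom)
  have hχ : Function.Injective χ := by
    intro p q hpq
    rw [← p.out_eq', ← q.out_eq', QuotientGroup.eq]
    refine hH _ fun h => ?_
    have hconj := DFunLike.congr_fun hpq (MulAut.conjNormal p.out h)
    simp only [χ, MonoidHom.comp_apply, Units.coeHom_apply, Units.val_inj] at hconj
    have hp : MulAut.conjNormal p.out⁻¹ (MulAut.conjNormal p.out h) = h :=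
      Subtype.ext (by simp)
    have hq : MulAut.conjNormal q.out⁻¹ (MulAut.conjNormal p.out h) =
        MulAut.conjNormal (p.out⁻¹ * q.out)⁻¹ h :=
      Subtype.ext (by simp [mul_assoc])
    rw [← hq]
    exact hconj.symm.trans (congrArg ψ hp)
  have hli : LinearIndependent k fun q : G ⧸ H => ρ q.out v := by
    refine linearIndependent_of_characters (ρ.comp H.subtype) χ hχ _ (fun q hq => hv ?_) ?_
    · have := congrArg (ρ q.out⁻¹) hq
      rwa [inv_self_apply, map_zero] at this
    · intro q h
      have e : (h : G) * q.out = q.out * (MulAut.conjNormal q.out⁻¹ h : H) := by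
        simp [mul_assoc]
      change ρ h (ρ q.out v) = (ψ (MulAut.conjNormal q.out⁻¹ h) : k) • ρ q.out v
      rw [← Module.End.mul_apply, ← map_mul, e, map_mul, Module.End.mul_apply, hψ, map_smul]
  refine ⟨Basis.mk hli (hρ _ ?_ ?_).ge, fun q => by simp⟩
  · rw [Submodule.ne_bot_iff]
    exact ⟨_, Submodule.subset_span ⟨((1 : G) : G ⧸ H), rfl⟩, hli.ne_zero _⟩
  · intro g w hw
    refine Submodule.span_induction ?_ (by simp) (fun x y _ _ hx hy => ?_)
      (fun c x _ hx => ?_) hw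
    · rintro _ ⟨q, rfl⟩
      obtain ⟨h, -, e⟩ := ρ.exists_apply_eq_smul_out hψ (g * q.out)
      rw [map_mul, Module.End.mul_apply] at e
      dsimp only
      rw [e]
      exact Submodule.smul_mem _ _ (Submodule.subset_span ⟨_, rfl⟩)
    · rw [map_add]; exact add_mem hx hy
    · rw [map_smul]; exact Submodule.smul_mem _ _ hx

end Representation

/-- The induced character formula as a sum over coset representatives. -/
theorem inducedCharFun_eq_sum_quotient {G : Type*} [Group G] [Fintype G] (H : Subgroup G)
    (ψ : H →* ℂˣ) (g : G) :
    inducedCharFun H (fun h => (ψ h : ℂ)) g =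
      ∑ q : G ⧸ H, if h : q.out⁻¹ * g * q.out ∈ H then (ψ ⟨_, h⟩ : ℂ) else 0 := by
  let F (x : G) : ℂ := if h : x⁻¹ * g * x ∈ H then (ψ ⟨_, h⟩ : ℂ) else 0
  have hF (x : G) : F x = F (x : G ⧸ H).out := by
    obtain ⟨h, hh⟩ := QuotientGroup.mk_out_eq_mul H x
    have e : (x * h)⁻¹ * g * (x * h) = (h : G)⁻¹ * (x⁻¹ * g * x) * h := by group
    simp only [F, hh, e]
    by_cases hx : x⁻¹ * g * x ∈ H
    · have hx' : (h : G)⁻¹ * (x⁻¹ * g * x) * h ∈ H :=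
        H.mul_mem (H.mul_mem (H.inv_mem h.2) hx) h.2
      have : (⟨_, hx'⟩ : H) = h⁻¹ * ⟨_, hx⟩ * h := rfl
      rw [dif_pos hx, dif_pos hx', this]
      simp [mul_comm]
    · have hx' : (h : G)⁻¹ * (x⁻¹ * g * x) * h ∉ H := by
        rwa [H.mul_mem_cancel_right h.2, H.mul_mem_cancel_left (H.inv_mem h.2)]
      rw [dif_neg hx, dif_neg hx']
  have hsum : ∑ x : G, F x = Nat.card H * ∑ q : G ⧸ H, F q.out := by
    rw [← Finset.sum_fiberwise Finset.univ (fun x : G => (x : G ⧸ H)), Finset.mul_sum]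
    refine Finset.sum_congr rfl fun q _ => ?_
    rw [Finset.sum_congr rfl (g := fun _ => F q.out) fun x hx => by
      rw [hF, (Finset.mem_filter.1 hx).2], Finset.sum_const, nsmul_eq_mul]
    have hcard := QuotientGroup.card_preimage_mk H {q}
    rw [Nat.card_unique (α := ({q} : Set (G ⧸ H))), mul_one] at hcard
    rw [← hcard, ← Fintype.card_subtype, ← Nat.card_eq_fintype_card]
    rfl
  have hinv : ∑ x : G, (if h : x * g * x⁻¹ ∈ H then (ψ ⟨x * g * x⁻¹, h⟩ : ℂ) else 0) =
      ∑ x : G, F x := by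
    rw [← Equiv.sum_comp (Equiv.inv G)]
    simp [F]
  rw [inducedCharFun, hinv, hsum, inv_mul_cancel_left₀]
  exact_mod_cast Nat.card_pos.ne'

namespace FDRep

variable {k : Type*} {G : Type*} [Field k] [Group G]

/-- A nonzero invariant subspace of a simple representation is the whole space. -/
theorem eq_top_of_simple_s15 (V : FDRep k G) [Simple V] (W : Submodule k V) (hW : W ≠ ⊥)
    (hinv : ∀ g, ∀ w ∈ W, V.ρ g w ∈ W) : W = ⊤ := by
  let σ : Representation k G W :=
    (⟨W, fun g w hw => hinv g w hw⟩ : Subrepresentation V.ρ).toRepresentation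
  let i : FDRep.of σ ⟶ V := ⟨FGModuleCat.ofHom W.subtype, fun g => by ext; rfl⟩
  have hinj : Function.Injective i := Subtype.val_injective
  have : Mono i := ConcreteCategory.mono_of_injective i hinj
  have hne : i ≠ 0 := by
    intro h
    obtain ⟨w, hw, hw0⟩ := W.ne_bot_iff.1 hW
    exact hw0 (congrArg (fun f : FDRep.of σ ⟶ V => f (⟨w, hw⟩ : W)) h)
  have := isIso_of_mono_of_nonzero hne
  exact Submodule.eq_top_of_finrank_eq (isoToLinearEquiv (asIso i)).finrank_eq

theorem nontrivial_of_simple (V : FDRep k G) [Simple V] : Nontrivial V := by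
  by_contra h
  rw [not_nontrivial_iff_subsingleton] at h
  refine id_nonzero V ?_
  ext x
  exact Subsingleton.elim _ _

end FDRep

/-- A finite group with an abelian normal subgroup whose quotient is abelian is
monomial. -/
theorem isMonomial_of_abelian_by_abelian
    (G : Type) [Group G] [Fintype G] (N : Subgroup G) [N.Normal]
    (hN : ∀ a b : N, a * b = b * a)
    (hQ : ∀ a b : G ⧸ N, a * b = b * a) :
    IsMonomial G := by
  intro V _
  have := V.nontrivial_of_simple
  obtain ⟨H, _, ψ, v, hv, hψ, hH⟩ :=
    Representation.exists_normal_character V.ρ N hN hQ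
  obtain ⟨b, hb⟩ :=
    Representation.exists_basis_of_normal_character V.ρ V.eq_top_of_simple_s15 H ψ v hv hψ hH
  refine ⟨H, ψ, fun g => ?_⟩
  rw [inducedCharFun_eq_sum_quotient]
  exact Representation.trace_eq_sum_quotient V.ρ H ψ v hψ b hb g
end

section
/- (Aramata–Brauer) Let G be a finite group. Then there exist finitely many cyclic subgroups H₁, …, Hₘ of G, one-dimensional characters ψᵢ : Hᵢ → ℂˣ, and positive rational numbers λ₁, …, λₘ such that for every g ∈ G, r_G(g) − 1 = Σᵢ λᵢ · Ind_{Hᵢ}^{G} ψᵢ (g). -/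
open Classical

open CategoryTheory

/-- The sum of a linear character over the generators of a subgroup is a rational integer. -/
lemma sum_generators_mem_range_intCast {A : Type*} [Group A] [Fintype A] (χ : A →* ℂˣ)
    (K : Subgroup A) :
    ∑ k : A with Subgroup.zpowers k = K, (χ k : ℂ) ∈ (Int.castRingHom ℂ).range := by
  induction K using WellFoundedLT.induction with
  | ind K ih =>
    have hfib : ∑ L : Subgroup A with L ≤ K, ∑ k : A with Subgroup.zpowers k = L, (χ k : ℂ)
        = ∑ k : A with k ∈ K, (χ k : ℂ) := by
      rw [← Finset.sum_fiberwise_of_maps_to (s := Finset.univ.filter (· ∈ K))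
        (t := Finset.univ.filter (· ≤ K)) (g := Subgroup.zpowers) (by simp)]
      refine Finset.sum_congr rfl fun L hL => Finset.sum_congr ?_ fun _ _ => rfl
      ext k
      simp only [Finset.mem_filter, Finset.mem_univ, true_and] at hL ⊢
      exact ⟨fun h => ⟨hL (h ▸ Subgroup.mem_zpowers k), h⟩, fun h => h.2⟩
    have hK : ∑ k : A with k ∈ K, (χ k : ℂ) ∈ (Int.castRingHom ℂ).range := by
      have hsub : ∑ k : A with k ∈ K, (χ k : ℂ) = ∑ k : K, (χ k : ℂ) :=
        Finset.sum_subtype _ (by simp) _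
      have hsum := sum_hom_units ((Units.coeHom ℂ).comp (χ.comp K.subtype))
      simp only [MonoidHom.comp_apply, Units.coeHom_apply, Subgroup.subtype_apply] at hsum
      rw [hsub, hsum]
      split_ifs
      · exact natCast_mem _ _
      · exact_mod_cast natCast_mem (Int.castRingHom ℂ).range 0
    rw [← hfib, ← Finset.add_sum_erase _ _ (a := K) (by simp)] at hK
    refine (add_mem_cancel_right (sum_mem fun L hL => ih L ?_)).1 hK
    simp only [Finset.mem_erase, Finset.mem_filter, Finset.mem_univ, true_and] at hL
    exact lt_of_le_of_ne hL.2 hL.1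

/-- Column orthogonality for the linear characters of a finite abelian group. -/
lemma sum_linearChar_apply {A : Type*} [CommGroup A] [Fintype A] [Fintype (A →* ℂˣ)] (a : A) :
    ∑ χ : A →* ℂˣ, (χ a : ℂ) = if a = 1 then (Nat.card A : ℂ) else 0 := by
  have : NeZero (Monoid.exponent A) := ⟨Monoid.exponent_ne_zero_of_finite⟩
  split_ifs with ha
  · subst ha
    have hcard := CommGroup.card_monoidHom_of_hasEnoughRootsOfUnity A ℂ
    rw [← hcard]
    simp
  · obtain ⟨φ, hφ⟩ := CommGroup.exists_apply_ne_one_of_hasEnoughRootsOfUnity A ℂ ha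
    have hmul : (φ a : ℂ) * ∑ χ : A →* ℂˣ, (χ a : ℂ) = ∑ χ : A →* ℂˣ, (χ a : ℂ) := by
      rw [Finset.mul_sum]
      exact Fintype.sum_equiv (Equiv.mulLeft φ) _ _ (by simp)
    have hne : (φ a : ℂ) - 1 ≠ 0 := by
      rw [sub_ne_zero]
      exact fun h => hφ (Units.ext h)
    exact (mul_eq_zero.1 (by linear_combination hmul :
      ((φ a : ℂ) - 1) * ∑ χ : A →* ℂˣ, (χ a : ℂ) = 0)).resolve_left hne

/-- `φ(|A|)` minus the sum of the values of `χ⁻¹` over the generators of `A`: the multiplicity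
of `χ` in `φ(|A|) r_A - θ_A`, where `θ_A` is `|A|` on generators and `0` elsewhere. -/
noncomputable def aramataMultiplicity {A : Type*} [Group A] [Fintype A] (χ : A →* ℂˣ) : ℂ :=
  ∑ k : A with Subgroup.zpowers k = ⊤, (1 - (χ⁻¹ k : ℂ))

lemma exists_nat_aramataMultiplicity {A : Type*} [Group A] [Fintype A] (χ : A →* ℂˣ) :
    ∃ n : ℕ, aramataMultiplicity χ = n := by
  obtain ⟨z, hz⟩ : aramataMultiplicity χ ∈ (Int.castRingHom ℂ).range := by
    rw [aramataMultiplicity, Finset.sum_sub_distrib]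
    exact sub_mem (sum_mem fun _ _ => one_mem _) (sum_generators_mem_range_intCast χ⁻¹ ⊤)
  have hre : 0 ≤ (aramataMultiplicity χ).re := by
    rw [aramataMultiplicity, Complex.re_sum]
    refine Finset.sum_nonneg fun k _ => ?_
    have hnorm : ‖(χ⁻¹ k : ℂ)‖ = 1 := by
      refine Complex.norm_eq_one_of_pow_eq_one (n := Fintype.card A) ?_ Fintype.card_ne_zero
      rw [← Units.val_pow_eq_pow_val, ← map_pow, pow_card_eq_one, map_one, Units.val_one]
    have := Complex.re_le_norm (χ⁻¹ k : ℂ)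
    rw [Complex.sub_re, Complex.one_re]
    linarith
  have hz0 : 0 ≤ z := by
    rw [← hz] at hre
    simpa using hre
  lift z to ℕ using hz0
  exact ⟨z, by simpa using hz.symm⟩

lemma isCyclic_of_aramataMultiplicity_ne_zero {A : Type*} [Group A] [Fintype A] {χ : A →* ℂˣ}
    (h : aramataMultiplicity χ ≠ 0) : IsCyclic A := by
  obtain ⟨k, hk, -⟩ := Finset.exists_ne_zero_of_sum_ne_zero h
  exact isCyclic_iff_exists_zpowers_eq_top.2 ⟨k, (Finset.mem_filter.1 hk).2⟩

lemma sum_aramataMultiplicity_mul {A : Type*} [Group A] [Fintype A] [Fintype (A →* ℂˣ)] (a : A) :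
    ∑ χ : A →* ℂˣ, aramataMultiplicity χ * (χ a : ℂ) = Nat.card A *
      ∑ k : A with Subgroup.zpowers k = ⊤, ((if a = 1 then 1 else 0) - if a = k then 1 else 0) := by
  simp only [aramataMultiplicity, Finset.sum_mul, Finset.mul_sum]
  rw [Finset.sum_comm]
  refine Finset.sum_congr rfl fun k hk => ?_
  have hcyc : IsCyclic A :=
    isCyclic_iff_exists_zpowers_eq_top.2 ⟨k, (Finset.mem_filter.1 hk).2⟩
  let : CommGroup A := IsCyclic.commGroup
  have h1 := sum_linearChar_apply a
  have h2 := sum_linearChar_apply (k⁻¹ * a)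
  have hterm : ∀ χ : A →* ℂˣ,
      (1 - (χ⁻¹ k : ℂ)) * (χ a : ℂ) = (χ a : ℂ) - (χ (k⁻¹ * a) : ℂ) := by
    intro χ
    rw [map_mul, map_inv, MonoidHom.inv_apply, Units.val_mul]
    ring
  refine (Finset.sum_congr rfl fun χ _ => hterm χ).trans ?_
  rw [Finset.sum_sub_distrib, h1, h2]
  simp only [inv_mul_eq_one, eq_comm (a := k)]
  split_ifs <;> simp

lemma zpowers_eq_top_iff_zpowers_coe_eq {G : Type*} [Group G] {H : Subgroup G} (k : H) :
    Subgroup.zpowers k = ⊤ ↔ Subgroup.zpowers (k : G) = H := by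
  rw [← (Subgroup.map_injective H.subtype_injective).eq_iff, MonoidHom.map_zpowers,
    ← MonoidHom.range_eq_map, Subgroup.range_subtype, Subgroup.subtype_apply]

lemma sum_generators_subgroup {G : Type*} [Group G] [Fintype G] (H : Subgroup G) (F : G → ℂ) :
    ∑ k : H with Subgroup.zpowers k = ⊤, F k = ∑ k : G with Subgroup.zpowers k = H, F k := by
  refine Finset.sum_bij (fun k _ => (k : G)) ?_ (fun _ _ _ _ h => Subtype.ext h) ?_
    (fun _ _ => rfl)
  · intro k hk
    simpa [zpowers_eq_top_iff_zpowers_coe_eq] using hk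
  · intro k hk
    have hk' : Subgroup.zpowers k = H := by simpa using hk
    exact ⟨⟨k, hk' ▸ Subgroup.mem_zpowers k⟩,
      by simpa [zpowers_eq_top_iff_zpowers_coe_eq] using hk', rfl⟩

lemma sum_aramataMultiplicity_mul_inducedCharFun {G : Type*} [Group G] [Fintype G]
    (H : Subgroup G) [Fintype (H →* ℂˣ)] (g : G) :
    ∑ χ : H →* ℂˣ, aramataMultiplicity χ * inducedCharFun H (fun h => (χ h : ℂ)) g =
      ∑ x : G, ∑ k : G with Subgroup.zpowers k = H,
        ((if g = 1 then 1 else 0) - if x * g * x⁻¹ = k then 1 else 0) := by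
  have hcard : (Nat.card H : ℂ) ≠ 0 := by exact_mod_cast Nat.card_pos.ne'
  simp only [inducedCharFun, Finset.mul_sum]
  rw [Finset.sum_comm]
  refine Finset.sum_congr rfl fun x _ => ?_
  have hone : x * g * x⁻¹ = 1 ↔ g = 1 := conj_eq_one_iff
  by_cases hx : x * g * x⁻¹ ∈ H
  · have key := sum_aramataMultiplicity_mul (⟨x * g * x⁻¹, hx⟩ : H)
    simp only [Subtype.ext_iff, Subgroup.coe_one, hone] at key
    rw [sum_generators_subgroup H
      (fun k => (if g = 1 then 1 else 0) - if x * g * x⁻¹ = k then 1 else 0)] at key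
    simp only [dif_pos hx, mul_left_comm _ (Nat.card H : ℂ)⁻¹]
    rw [← Finset.mul_sum, key, inv_mul_cancel_left₀ hcard]
  · simp only [dif_neg hx, mul_zero, Finset.sum_const_zero]
    refine (Finset.sum_eq_zero fun k hk => ?_).symm
    have hk' : Subgroup.zpowers k = H := by simpa using hk
    have h1 : g ≠ 1 := fun h => hx (by rw [hone.2 h]; exact H.one_mem)
    have h2 : x * g * x⁻¹ ≠ k := fun h => hx (by rw [h, ← hk']; exact Subgroup.mem_zpowers k)
    simp [h1, h2]

lemma sum_sum_aramataMultiplicity {G : Type*} [Group G] [Fintype G]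
    [∀ H : Subgroup G, Fintype (H →* ℂˣ)] (g : G) :
    ∑ H : Subgroup G, ∑ χ : H →* ℂˣ,
        aramataMultiplicity χ * inducedCharFun H (fun h => (χ h : ℂ)) g =
      Nat.card G * ((if g = 1 then (Nat.card G : ℂ) else 0) - 1) := by
  simp only [sum_aramataMultiplicity_mul_inducedCharFun]
  rw [Finset.sum_comm]
  refine (Finset.sum_congr rfl fun x _ => Finset.sum_fiberwise Finset.univ Subgroup.zpowers
    fun k => ((if g = 1 then 1 else 0) - if x * g * x⁻¹ = k then 1 else 0)).trans ?_
  simp only [Finset.sum_sub_distrib, Finset.sum_ite_eq, Finset.mem_univ,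
    if_true, Finset.sum_const, Finset.card_univ, Nat.card_eq_fintype_card, nsmul_eq_mul]
  split_ifs <;> ring

/-- (Aramata–Brauer) For a finite group `G` there are cyclic subgroups `Hᵢ ≤ G`,
one-dimensional characters `ψᵢ : Hᵢ → ℂˣ` and positive rationals `λᵢ` such that
`r_G - 1 = ∑ᵢ λᵢ · Ind_{Hᵢ}^G ψᵢ`, where `r_G` is the character of the regular
representation of `G`. -/
theorem aramata_brauer
    (G : Type*) [Group G] [Fintype G] :
    ∃ (m : ℕ) (H : Fin m → Subgroup G) (ψ : ∀ i, (H i) →* ℂˣ) (lam : Fin m → ℚ),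
      (∀ i, IsCyclic (H i)) ∧ (∀ i, 0 < lam i) ∧
      ∀ g : G, (if g = 1 then (Nat.card G : ℂ) else 0) - 1 =
        ∑ i, (lam i : ℂ) * inducedCharFun (H i) (fun h => ((ψ i) h : ℂ)) g := by
  have (H : Subgroup G) : Fintype (H →* ℂˣ) := Fintype.ofFinite _
  choose n hn using fun p : (Σ H : Subgroup G, H →* ℂˣ) => exists_nat_aramataMultiplicity p.2
  let e := Fintype.equivFin {p : (Σ H : Subgroup G, H →* ℂˣ) // n p ≠ 0}
  have hG : (Nat.card G : ℂ) ≠ 0 := by exact_mod_cast Nat.card_pos.ne'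
  refine ⟨_, fun i => (e.symm i).1.1, fun i => (e.symm i).1.2,
    fun i => n (e.symm i).1 / Nat.card G, fun i => ?_, fun i => ?_, fun g => ?_⟩
  · refine isCyclic_of_aramataMultiplicity_ne_zero (χ := (e.symm i).1.2) ?_
    rw [hn]
    exact_mod_cast (e.symm i).2
  · have := Nat.pos_of_ne_zero (e.symm i).2
    have := Nat.card_pos (α := G)
    positivity
  · let F : (Σ H : Subgroup G, H →* ℂˣ) → ℂ := fun p =>
      ((n p / Nat.card G : ℚ) : ℂ) * inducedCharFun p.1 (fun h => (p.2 h : ℂ)) g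
    calc (if g = 1 then (Nat.card G : ℂ) else 0) - 1 = ∑ p, F p := by
          rw [← mul_right_inj' hG, ← sum_sum_aramataMultiplicity, Fintype.sum_sigma,
            Finset.mul_sum]
          refine Finset.sum_congr rfl fun H _ => ?_
          rw [Finset.mul_sum]
          refine Finset.sum_congr rfl fun χ _ => ?_
          simp only [F, hn ⟨H, χ⟩]
          push_cast
          field_simp
      _ = ∑ p : {p : (Σ H : Subgroup G, H →* ℂˣ) // n p ≠ 0}, F p := by
          rw [← Finset.sum_filter_of_ne (p := fun p => n p ≠ 0) (by
            intro p _ hp h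
            simp [F, h] at hp)]
          exact Finset.sum_subtype _ (by simp) _
      _ = ∑ i, F (e.symm i) := (Equiv.sum_comp e.symm _).symm
end

section
/- Let G be a finite group, let N be a normal subgroup of G of prime index p, and let ψ be an irreducible finite-dimensional complex representation of N. Then the induced representation Ind_N^G ψ decomposes as a direct sum of irreducible representations of G all of which have the same degree, and this common degree is either deg ψ or p · deg ψ. -/
open Classical

open CategoryTheory

/-- A homomorphism on a normal subgroup `N` extends to a group generated by `N` and `z` as soon as
one prescribes a compatible value `t` at `z`. -/
theorem MonoidHom.exists_extension_of_cyclic_quotient {G M : Type*} [Group G] [Group M]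
    (N : Subgroup G) [N.Normal] (f : N →* M) (z : G) (t : M) (p : ℕ) (hzp : z ^ p ∈ N)
    (hgen : ∀ g : G, ∃ (n : N) (j : ℤ), g = n * z ^ j)
    (hdvd : ∀ j : ℤ, z ^ j ∈ N → (p : ℤ) ∣ j)
    (hconj : ∀ n : N, f (MulAut.conjNormal z n) = t * f n * t⁻¹)
    (hpow : f ⟨z ^ p, hzp⟩ = t ^ p) :
    ∃ F : G →* M, (∀ n : N, F n = f n) ∧ F z = t := by
  let S : Subgroup (G × M) :=
    { carrier := {x | ∀ n : N, f (MulAut.conjNormal x.1 n) = x.2 * f n * x.2⁻¹}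
      one_mem' := by simp
      mul_mem' := fun {x y} hx hy n => by
        simp only [Set.mem_ofPred_eq] at hx hy
        simp [hx, hy, mul_assoc]
      inv_mem' := fun {x} hx n => by
        simp only [Set.mem_ofPred_eq] at hx
        have h := hx (MulAut.conjNormal x.1⁻¹ n)
        rw [← MulAut.mul_apply, ← map_mul, mul_inv_cancel, map_one, MulAut.one_apply] at h
        simp only [Prod.fst_inv, Prod.snd_inv, h]
        group }
  have hS : ∀ (j : ℤ) (n : N), f (MulAut.conjNormal (z ^ j) n) = t ^ j * f n * (t ^ j)⁻¹ :=
    fun j n => zpow_mem (show (z, t) ∈ S from hconj) j n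
  let φ : Multiplicative ℤ →* MulAut N := MulAut.conjNormal.comp (zpowersHom G z)
  let A : N ⋊[φ] Multiplicative ℤ →* G := SemidirectProduct.lift N.subtype (zpowersHom G z)
    (fun j => by ext n; simp [φ, -map_zpow])
  let B : N ⋊[φ] Multiplicative ℤ →* M := SemidirectProduct.lift f (zpowersHom M t)
    (fun j => by ext n; simpa [φ, -map_zpow] using hS _ n)
  have hA : Function.Surjective A := fun g => by
    obtain ⟨n, j, rfl⟩ := hgen g
    exact ⟨⟨n, Multiplicative.ofAdd j⟩, by simp [A, SemidirectProduct.lift]⟩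
  have hker : A.ker ≤ B.ker := by
    rintro ⟨n, j⟩ h
    simp only [MonoidHom.mem_ker, A, B, SemidirectProduct.lift, MonoidHom.coe_mk, OneHom.coe_mk,
      zpowersHom_apply, Subgroup.coe_subtype] at h ⊢
    have hn : z ^ (Multiplicative.toAdd j) = (n⁻¹ : N) := by
      rw [N.coe_inv]; exact eq_inv_of_mul_eq_one_right h
    obtain ⟨k, hk⟩ := hdvd _ (hn ▸ (n⁻¹).2)
    have hn' : n⁻¹ = (⟨z ^ p, hzp⟩ : N) ^ k := by
      ext; rw [← hn, hk, zpow_mul]; simp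
    rw [hk, zpow_mul, zpow_natCast, ← hpow, ← map_zpow, ← hn', ← map_mul, mul_inv_cancel, map_one]
  let F := A.liftOfSurjective hA ⟨B, hker⟩
  have hF : ∀ x, F (A x) = B x := fun x => A.liftOfRightInverse_comp_apply _ _ ⟨B, hker⟩ x
  refine ⟨F, fun n => ?_, ?_⟩
  · simpa [A, B] using hF (SemidirectProduct.inl n)
  · simpa [A, B] using hF (SemidirectProduct.inr (Multiplicative.ofAdd 1))

/-- The trace of an endomorphism of `ι → V` is the sum of the traces of its diagonal blocks. -/
theorem LinearMap.trace_pi_eq_sum {R V ι : Type*} [Field R] [AddCommGroup V] [Module R V]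
    [FiniteDimensional R V] [Fintype ι] (A : (ι → V) →ₗ[R] (ι → V)) :
    LinearMap.trace R (ι → V) A =
      ∑ i, LinearMap.trace R V (LinearMap.proj i ∘ₗ A ∘ₗ LinearMap.single R (fun _ => V) i) := by
  have h : A = ∑ i, (A ∘ₗ LinearMap.single R (fun _ => V) i) ∘ₗ LinearMap.proj i := by
    ext i v : 2
    simp only [LinearMap.comp_apply, LinearMap.sum_apply, LinearMap.proj_apply]
    rw [Finset.sum_eq_single i (fun j _ hj => by simp [hj]) (by simp)]
    simp
  conv_lhs => rw [h, map_sum]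
  exact Finset.sum_congr rfl fun i _ => LinearMap.trace_comp_comm' _ _

/-- **Schur's lemma**: a linear map commuting with a simple complex representation is a scalar. -/
theorem FDRep.exists_eq_smul_of_commute {H : Type} [Group H] (ψ : FDRep ℂ H) [Simple ψ]
    (f : ψ →ₗ[ℂ] ψ) (hf : ∀ h, Commute f (ψ.ρ h)) : ∃ c : ℂ, f = c • LinearMap.id := by
  let F : ψ ⟶ ψ := ⟨InducedCategory.homMk (ModuleCat.ofHom f), fun g ↦ by
    ext v
    exact LinearMap.congr_fun (hf g) v⟩
  obtain ⟨c, hc⟩ := endomorphism_simple_eq_smul_id ℂ F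
  refine ⟨c, ?_⟩
  ext v
  exact (congrArg (fun k : ψ ⟶ ψ => k.hom.hom.hom v) hc).symm

/-- A representation of `G` whose restriction to `N` is simple is simple. -/
theorem FDRep.simple_of_restrict {G : Type} [Group G] [Finite G] {N : Subgroup G}
    (ψ : FDRep ℂ N) [Simple ψ] (ρ : Representation ℂ G ψ) (h : ∀ n : N, ρ n = ψ.ρ n) :
    Simple (FDRep.of ρ) := by
  rw [FDRep.simple_iff_end_is_rank_one]
  have hne : 𝟙 (FDRep.of ρ) ≠ 0 := by
    intro h0
    apply id_nonzero ψ
    ext v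
    exact congrArg (fun k : FDRep.of ρ ⟶ FDRep.of ρ => k.hom.hom.hom v) h0
  rw [finrank_eq_one_iff_of_nonzero' _ hne]
  intro f
  obtain ⟨c, hc⟩ := FDRep.exists_eq_smul_of_commute ψ f.hom.hom.hom (fun n => by
    ext v
    have := congrArg (fun k => k.hom.hom v) (f.comm (n : G))
    rw [← h]
    exact this)
  refine ⟨c, ?_⟩
  ext v
  exact (LinearMap.congr_fun hc v).symm

/-- The character of a coinduced representation is given by the induced-character formula. -/
theorem Representation.character_coind {G V : Type} [Group G] [Fintype G] [AddCommGroup V]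
    [Module ℂ V] [FiniteDimensional ℂ V] (N : Subgroup G) (ρ : Representation ℂ N V) (g : G) :
    (Representation.coind N.subtype ρ).character g = inducedCharFun N ρ.character g := by
  let L : (G → V) →ₗ[ℂ] (G → V) := LinearMap.pi fun x =>
    (Nat.card N : ℂ)⁻¹ • ∑ n : N, ρ n ∘ₗ LinearMap.proj ((n : G)⁻¹ * x * g)
  have hLapp : ∀ f x, L f x = (Nat.card N : ℂ)⁻¹ • ∑ n : N, ρ n (f ((n : G)⁻¹ * x * g)) := by
    intro f x
    simp [L]
  have hL : ∀ f, L f ∈ Representation.coindV N.subtype ρ := by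
    intro f n x
    rw [hLapp, hLapp, map_smul, map_sum]
    congr 1
    refine Fintype.sum_equiv (Equiv.mulLeft n⁻¹) _ _ fun m => ?_
    rw [← Module.End.mul_apply, ← map_mul]
    simp [mul_assoc]
  have hcard : (Nat.card N : ℂ) ≠ 0 := Nat.cast_ne_zero.2 Nat.card_pos.ne'
  have hres : Representation.coind N.subtype ρ g = L.restrict (fun x _ => hL x) := by
    ext f x
    have hf := f.2
    rw [Representation.mem_coindV] at hf
    rw [LinearMap.coe_restrict_apply, hLapp]
    have : ∀ n : N, ρ n (f.1 ((n : G)⁻¹ * x * g)) = f.1 (x * g) := fun n => by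
      rw [← hf]; simp [mul_assoc]
    simp only [this]
    rw [Finset.sum_const, Finset.card_univ, ← Nat.card_eq_fintype_card, ← Nat.cast_smul_eq_nsmul ℂ,
      smul_smul, inv_mul_cancel₀ hcard, one_smul]
    rfl
  rw [Representation.character, hres, LinearMap.trace_restrict_eq_of_forall_mem _ _ hL,
    LinearMap.trace_pi_eq_sum, inducedCharFun, Finset.mul_sum]
  refine Finset.sum_congr rfl fun x _ => ?_
  have hblock : LinearMap.proj x ∘ₗ L ∘ₗ LinearMap.single ℂ (fun _ => V) x =
      (Nat.card N : ℂ)⁻¹ • ∑ n : N, if (n : G) = x * g * x⁻¹ then ρ n else 0 := by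
    ext v
    simp only [LinearMap.comp_apply, LinearMap.proj_apply, hLapp, LinearMap.smul_apply,
      LinearMap.sum_apply]
    congr 1
    refine Finset.sum_congr rfl fun n _ => ?_
    have : (n : G)⁻¹ * x * g = x ↔ (n : G) = x * g * x⁻¹ := by
      rw [mul_assoc, inv_mul_eq_iff_eq_mul, eq_mul_inv_iff_mul_eq, eq_comm]
    by_cases h : (n : G) = x * g * x⁻¹
    · rw [if_pos h, this.2 h]; simp
    · rw [if_neg h]
      simp [mt this.1 h]
  rw [hblock, map_smul, map_sum, smul_eq_mul]
  congr 1
  split_ifs with h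
  · rw [Finset.sum_eq_single ⟨x * g * x⁻¹, h⟩]
    · simp [Representation.character]
    · intro n _ hn
      rw [if_neg fun h' => hn (Subtype.ext h'), map_zero]
    · simp
  · refine Finset.sum_eq_zero fun n _ => ?_
    rw [if_neg fun h' : (n : G) = x * g * x⁻¹ => h (h' ▸ n.2), map_zero]

/-- The conjugate of a representation of a normal subgroup by an element of the ambient group. -/
noncomputable abbrev FDRep.conjNormal {G : Type} [Group G] {N : Subgroup G} [N.Normal]
    (ψ : FDRep ℂ N) (z : G) : FDRep ℂ N :=
  FDRep.of (ψ.ρ.comp (MulAut.conjNormal z).toMonoidHom)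

theorem FDRep.simple_conjNormal {G : Type} [Group G] [Fintype G] {N : Subgroup G} [N.Normal]
    (ψ : FDRep ℂ N) [hψ : Simple ψ] (z : G) : Simple (ψ.conjNormal z) := by
  rw [FDRep.simple_iff_char_is_norm_one] at hψ ⊢
  rw [← hψ]
  refine Fintype.sum_equiv (MulAut.conjNormal z).toEquiv _ _ fun n => ?_
  simp [FDRep.character]

theorem inducedCharFun_of_notMem {G : Type} [Group G] [Fintype G] (N : Subgroup G) [hN : N.Normal]
    (f : N → ℂ) {g : G} (hg : g ∉ N) : inducedCharFun N f g = 0 := by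
  rw [inducedCharFun, Finset.sum_eq_zero, mul_zero]
  intro x _
  rw [dif_neg]
  rwa [← hN.mem_comm_iff, inv_mul_cancel_left]

theorem inducedCharFun_coe {G : Type} [Group G] [Fintype G] (N : Subgroup G) [N.Normal]
    (f : N → ℂ) (n : N) :
    inducedCharFun N f n = (Nat.card N : ℂ)⁻¹ * ∑ x : G, f (MulAut.conjNormal x n) := by
  rw [inducedCharFun]
  congr 1
  refine Finset.sum_congr rfl fun x _ => ?_
  rw [dif_pos (‹N.Normal›.conj_mem _ n.2 x)]
  congr 1

/-- If no conjugate of `ψ` by an element outside `N` is isomorphic to `ψ`, then the representation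
coinduced from `ψ` is simple. -/
theorem FDRep.simple_coind {G : Type} [Group G] [Fintype G] {N : Subgroup G} [N.Normal]
    (ψ : FDRep ℂ N) [hψ : Simple ψ] (h : ∀ z ∉ N, IsEmpty (ψ ≅ ψ.conjNormal z)) :
    Simple (FDRep.of (Representation.coind N.subtype ψ.ρ)) := by
  have hcard : (Nat.card N : ℂ) ≠ 0 := Nat.cast_ne_zero.2 Nat.card_pos.ne'
  have hchar : ∀ g, (FDRep.of (Representation.coind N.subtype ψ.ρ)).character g =
      inducedCharFun N ψ.character g := Representation.character_coind N ψ.ρ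
  have hortho : ∀ z : G, ∑ n : N, ψ.character n * ψ.character (MulAut.conjNormal z n⁻¹) =
      if z ∈ N then (Nat.card N : ℂ) else 0 := by
    intro z
    split_ifs with hz
    · rw [← (FDRep.simple_iff_char_is_norm_one ψ).1 hψ]
      refine Finset.sum_congr rfl fun n _ => ?_
      rw [← FDRep.char_conj ψ n⁻¹ ⟨z, hz⟩]
      rfl
    · have := ψ.simple_conjNormal z
      have := invertibleOfNonzero hcard
      have horth := FDRep.char_orthonormal ψ (ψ.conjNormal z)
      rw [if_neg (not_nonempty_iff.2 (h z hz))] at horth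
      exact (mul_eq_zero.1 horth).resolve_left (inv_ne_zero hcard)
  rw [FDRep.simple_iff_char_is_norm_one]
  simp only [hchar]
  have hsub : ∑ g : G, inducedCharFun N ψ.character g * inducedCharFun N ψ.character g⁻¹ =
      ∑ n : N, inducedCharFun N ψ.character n * inducedCharFun N ψ.character (n⁻¹ : N) := by
    refine (Fintype.sum_of_injective _ N.subtype_injective _ _ (fun g hg => ?_) fun n => rfl).symm
    rw [inducedCharFun_of_notMem N _ (by simpa using hg), zero_mul]
  rw [hsub]
  simp only [inducedCharFun_coe]
  calc _ = (Nat.card N : ℂ)⁻¹ * (Nat.card N : ℂ)⁻¹ * ∑ x : G, ∑ y : G, ∑ n : N,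
        ψ.character (MulAut.conjNormal x n) * ψ.character (MulAut.conjNormal y n⁻¹) := by
        rw [Finset.mul_sum]
        simp_rw [mul_mul_mul_comm, Finset.sum_mul_sum]
        rw [← Finset.mul_sum, ← Finset.mul_sum, Finset.sum_comm]
        simp_rw [fun x : G => Finset.sum_comm (s := (Finset.univ : Finset N)) (t := Finset.univ)
          (f := fun n y => ψ.character (MulAut.conjNormal x n) *
            ψ.character (MulAut.conjNormal y n⁻¹))]
    _ = (Nat.card N : ℂ)⁻¹ * (Nat.card N : ℂ)⁻¹ * ∑ x : G, ∑ y : G, ∑ n : N,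
        ψ.character n * ψ.character (MulAut.conjNormal (y * x⁻¹) n⁻¹) := by
        congr 1
        refine Finset.sum_congr rfl fun x _ => Finset.sum_congr rfl fun y _ => ?_
        refine Fintype.sum_equiv (MulAut.conjNormal x).toEquiv _ _ fun n => ?_
        congr 2
        ext
        simp [mul_assoc]
    _ = (Nat.card N : ℂ)⁻¹ * (Nat.card N : ℂ)⁻¹ * ∑ x : G, ∑ y : G,
        if y ∈ N then (Nat.card N : ℂ) else 0 := by
        congr 1
        refine Finset.sum_congr rfl fun x _ => ?_
        simp only [hortho]
        exact Fintype.sum_equiv (Equiv.mulRight x⁻¹) _ _ fun y => rfl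
    _ = Nat.card G := by
        rw [← Finset.sum_filter]
        simp only [Finset.sum_const, Finset.card_univ, nsmul_eq_mul, ← Fintype.card_subtype]
        rw [← Nat.card_eq_fintype_card, ← Nat.card_eq_fintype_card]
        field_simp

/-- If `N` has prime index `p` and `ψ` is isomorphic to its conjugate by some element outside `N`,
then the induced character of `ψ` is the sum of the characters of `p` extensions of `ψ` to `G`. -/
theorem FDRep.inducedCharFun_eq_sum_of_conj_iso {G : Type} [Group G] [Fintype G] {N : Subgroup G}
    [N.Normal] {p : ℕ} (hp : p.Prime) (hidx : N.index = p) (ψ : FDRep ℂ N) [hψ : Simple ψ]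
    {z : G} (hz : z ∉ N) (i : ψ ≅ ψ.conjNormal z) :
    ∃ ρ : Fin p → Representation ℂ G ψ, (∀ i (n : N), ρ i n = ψ.ρ n) ∧
      ∀ g, inducedCharFun N ψ.character g = ∑ i, (FDRep.of (ρ i)).character g := by
  have hcard : (Nat.card N : ℂ) ≠ 0 := Nat.cast_ne_zero.2 Nat.card_pos.ne'
  have : Fact p.Prime := ⟨hp⟩
  have hzp : z ^ p ∈ N := hidx ▸ N.pow_index_mem z
  have hz1 : (z : G ⧸ N) ≠ 1 := mt (QuotientGroup.eq_one_iff z).1 hz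
  have hgen : ∀ g : G, ∃ (n : N) (j : ℤ), g = n * z ^ j := by
    intro g
    obtain ⟨j, hj⟩ := mem_zpowers_of_prime_card (G := G ⧸ N) (p := p) hidx hz1 (g' := (g : G ⧸ N))
    refine ⟨⟨g * (z ^ j)⁻¹, ?_⟩, j, by simp⟩
    rw [← QuotientGroup.eq_one_iff, QuotientGroup.mk_mul, QuotientGroup.mk_inv,
      QuotientGroup.mk_zpow, ← hj]
    exact mul_inv_cancel _
  have hdvd : ∀ j : ℤ, z ^ j ∈ N → (p : ℤ) ∣ j := by
    intro j hj
    have hord : orderOf (z : G ⧸ N) = p := orderOf_eq_prime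
      (by rw [← QuotientGroup.mk_pow, QuotientGroup.eq_one_iff]; exact hzp) hz1
    rw [← hord, orderOf_dvd_iff_zpow_eq_one, ← QuotientGroup.mk_zpow, QuotientGroup.eq_one_iff]
    exact hj
  let f : N →* (Module.End ℂ ψ)ˣ := ψ.ρ.toHomUnits
  obtain ⟨e, he⟩ : ∃ e : ψ ≃ₗ[ℂ] ψ, ∀ n : N, ψ.ρ (MulAut.conjNormal z n) = e.conj (ψ.ρ n) :=
    ⟨FDRep.isoToLinearEquiv (V := ψ) (W := ψ.conjNormal z) i, FDRep.Iso.conj_ρ i⟩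
  let t₀ : (Module.End ℂ ψ)ˣ := (LinearMap.GeneralLinearGroup.generalLinearEquiv ℂ ψ).symm e
  have ht₀ : ∀ n : N, f (MulAut.conjNormal z n) = t₀ * f n * t₀⁻¹ := fun n => Units.ext (he n)
  have ht₀_pow : ∀ (k : ℕ) (n : N),
      f (MulAut.conjNormal (z ^ k) n) = t₀ ^ k * f n * (t₀ ^ k)⁻¹ := by
    intro k
    induction k with
    | zero => simp
    | succ k ih =>
      intro n
      rw [pow_succ z, map_mul, MulAut.mul_apply, ih, ht₀]
      group
  let σ : ℂˣ →* (Module.End ℂ ψ)ˣ := Units.map (algebraMap ℂ (Module.End ℂ ψ)).toMonoidHom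
  have hσ : ∀ a u, Commute (σ a) u := fun a u => Units.ext (Algebra.commutes _ _)
  obtain ⟨a, ha⟩ : ∃ a : ℂˣ, (f ⟨z ^ p, hzp⟩)⁻¹ * t₀ ^ p = σ a := by
    set s := (f ⟨z ^ p, hzp⟩)⁻¹ * t₀ ^ p with hs
    have hcomm : ∀ n : N, s * f n = f n * s := by
      intro n
      have hn : MulAut.conjNormal (z ^ p) n = ⟨z ^ p, hzp⟩ * n * ⟨z ^ p, hzp⟩⁻¹ := by
        ext; simp [-map_pow]
      have := ht₀_pow p n
      rw [hn, map_mul, map_mul, map_inv] at this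
      rw [hs, mul_assoc, mul_inv_eq_iff_eq_mul.1 this.symm]
      group
    obtain ⟨c, hc⟩ := FDRep.exists_eq_smul_of_commute ψ s.val
      fun n => congrArg Units.val (hcomm n)
    have hc0 : c ≠ 0 := by
      rintro rfl
      rw [zero_smul] at hc
      apply id_nonzero ψ
      ext v
      have h1 : (1 : Module.End ℂ ψ) = 0 := by rw [← s.mul_inv, hc, zero_mul]
      exact LinearMap.congr_fun h1 v
    exact ⟨Units.mk0 c hc0, Units.ext hc⟩
  obtain ⟨b, hb⟩ : ∃ b : ℂˣ, b ^ p = a⁻¹ := by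
    obtain ⟨b, hb⟩ := IsAlgClosed.exists_pow_nat_eq (a⁻¹ : ℂˣ).val hp.pos
    have hb0 : b ≠ 0 := by
      rintro rfl
      rw [zero_pow hp.ne_zero] at hb
      exact (a⁻¹).ne_zero hb.symm
    exact ⟨Units.mk0 b hb0, Units.ext hb⟩
  have hζ₀ := Complex.isPrimitiveRoot_exp p hp.ne_zero
  obtain ⟨ζ, hζ⟩ : ∃ ζ : ℂˣ, IsPrimitiveRoot ζ p :=
    ⟨_, hζ₀.isUnit_unit hp.ne_zero⟩
  have hF : ∀ j : Fin p, ∃ F : G →* (Module.End ℂ ψ)ˣ,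
      (∀ n : N, F n = f n) ∧ F z = σ (ζ ^ (j : ℕ) * b) * t₀ := by
    intro j
    refine MonoidHom.exists_extension_of_cyclic_quotient N f z _ p hzp hgen hdvd (fun n => ?_) ?_
    · rw [ht₀, mul_inv_rev, mul_assoc (σ _), mul_assoc (σ _), (hσ _ _).eq]
      group
    · rw [(hσ _ _).mul_pow, ← map_pow, mul_pow, hb, pow_right_comm, hζ.pow_eq_one, one_pow, one_mul,
        (hσ _ _).eq, map_inv, ← ha]
      group
  choose F hFN hFz using hF
  refine ⟨fun j => (Units.coeHom _).comp (F j), fun j n => congrArg Units.val (hFN j n),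
    fun g => ?_⟩
  let W : Fin p → FDRep ℂ G := fun j =>
    FDRep.of ((Units.coeHom (Module.End ℂ ψ)).comp (F j) : Representation ℂ G ψ)
  change _ = ∑ j, (W j).character g
  have hWN : ∀ j (n : N), (W j).character n = ψ.character n := fun j n =>
    congrArg (fun u : (Module.End ℂ ψ)ˣ => LinearMap.trace ℂ ψ u) (hFN j n)
  by_cases hg : g ∈ N
  · lift g to N using hg
    have hconj : ∀ x : G, ψ.character (MulAut.conjNormal x g) = ψ.character g := fun x => by
      rw [← hWN ⟨0, hp.pos⟩, ← hWN ⟨0, hp.pos⟩, MulAut.conjNormal_apply, FDRep.char_conj]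
    simp only [inducedCharFun_coe, hconj, hWN, Finset.sum_const, Finset.card_univ,
      nsmul_eq_mul, ← Nat.card_eq_fintype_card, Nat.card_fin]
    rw [← N.card_mul_index, hidx, Nat.cast_mul, mul_assoc, inv_mul_cancel_left₀ hcard]
  · rw [inducedCharFun_of_notMem N _ hg]
    obtain ⟨n, j, rfl⟩ := hgen g
    have hj : ζ ^ j ≠ 1 := fun h => hg <| by
      obtain ⟨k, rfl⟩ := (hζ.zpow_eq_one_iff_dvd j).1 h
      rw [zpow_mul, zpow_natCast]
      exact N.mul_mem n.2 (N.zpow_mem hzp k)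
    have hjp : (ζ ^ j) ^ p = 1 := by
      rw [← zpow_natCast, zpow_comm, zpow_natCast, hζ.pow_eq_one, one_zpow]
    have hW : ∀ i, (W i).character (n * z ^ j) =
        (ζ ^ j : ℂˣ) ^ (i : ℕ) * ((b ^ j : ℂˣ) * LinearMap.trace ℂ ψ (f n * t₀ ^ j).val) := by
      intro i
      have h1 : F i (n * z ^ j) = σ ((ζ ^ j) ^ (i : ℕ) * b ^ j) * (f n * t₀ ^ j) := by
        rw [map_mul, map_zpow, hFN, hFz, (hσ _ _).mul_zpow, ← map_zpow, mul_zpow,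
          ← zpow_natCast (ζ ^ j), ← zpow_natCast ζ, zpow_comm, ← mul_assoc, ← mul_assoc,
          (hσ _ (f n)).eq]
      have h2 : (F i (n * z ^ j)).val =
          (((ζ ^ j) ^ (i : ℕ) * b ^ j : ℂˣ) : ℂ) • (f n * t₀ ^ j).val := by
        rw [h1, Algebra.smul_def]
        rfl
      change LinearMap.trace ℂ ψ (F i (n * z ^ j)).val = _
      rw [h2, map_smul, smul_eq_mul, Units.val_mul, Units.val_pow_eq_pow_val, mul_assoc]
    rw [Finset.sum_congr rfl fun i _ => hW i, ← Finset.sum_mul,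
      Fin.sum_univ_eq_sum_range (fun i => ((ζ ^ j : ℂˣ) : ℂ) ^ i),
      geom_sum_eq (mt Units.val_eq_one.1 hj), ← Units.val_pow_eq_pow_val, hjp]
    simp

/-- If `N` is a normal subgroup of prime index `p` in a finite group `G` and `ψ` is an
irreducible complex representation of `N`, then the induced representation `Ind_N^G ψ`
decomposes as a direct sum of irreducible representations of `G` all of the same degree
`d`, where `d = deg ψ` or `d = p * deg ψ`. (The decomposition is expressed at the level
of characters, which determine complex representations of finite groups up to
isomorphism.) -/
theorem clifford_induction_prime_index
    (G : Type) [Group G] [Fintype G] (N : Subgroup G) [N.Normal]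
    (p : ℕ) (hp : p.Prime) (hidx : N.index = p)
    (ψ : FDRep ℂ N) (hψ : Simple ψ) :
    ∃ (k d : ℕ) (W : Fin k → FDRep ℂ G),
      (∀ i, Simple (W i)) ∧ (∀ i, Module.finrank ℂ (W i) = d) ∧
      (d = Module.finrank ℂ ψ ∨ d = p * Module.finrank ℂ ψ) ∧
      ∀ g : G, inducedCharFun N (fun h => ψ.character h) g = ∑ i, (W i).character g := by
  by_cases h : ∃ z ∉ N, Nonempty (ψ ≅ ψ.conjNormal z)
  · obtain ⟨z, hz, ⟨i⟩⟩ := h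
    obtain ⟨ρ, hρ, hsum⟩ := ψ.inducedCharFun_eq_sum_of_conj_iso hp hidx hz i
    exact ⟨p, Module.finrank ℂ ψ, fun i => FDRep.of (ρ i),
      fun i => ψ.simple_of_restrict (ρ i) (hρ i), fun _ => rfl, Or.inl rfl, hsum⟩
  · push Not at h
    have hchar := Representation.character_coind N ψ.ρ
    refine ⟨1, p * Module.finrank ℂ ψ, fun _ => FDRep.of (Representation.coind N.subtype ψ.ρ),
      fun _ => ψ.simple_coind h, fun _ => ?_, Or.inr rfl, fun g => ?_⟩
    · have h1 := hchar 1
      have hcard : (Nat.card N : ℂ) ≠ 0 := Nat.cast_ne_zero.2 Nat.card_pos.ne'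
      rw [Representation.char_one, ← N.coe_one, inducedCharFun_coe] at h1
      simp only [map_one, Representation.char_one, Finset.sum_const, Finset.card_univ,
        nsmul_eq_mul, ← Nat.card_eq_fintype_card, ← N.card_mul_index, hidx] at h1
      rw [Nat.cast_mul, mul_assoc, inv_mul_cancel_left₀ hcard] at h1
      exact_mod_cast h1
    · rw [Fin.sum_univ_one]
      exact (hchar g).symm
end
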